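/- arXiv:2603.17630 — 2 statements merged into one kernel-verified Lean document; each statement's English description precedes it below -/
import Mathlib

section
/- There exist constants c > 0 and d_0 such that for every d ≥ d_0 and every n sufficiently large relative to d the following holds: if G is a connected graph with n vertices and minimum degree at least d, then the number of pairwise non-isomorphic spanning trees of G is at least n^{c·d}. -/
open Finset Function

namespace SpanningTreeCount

variable {V : Type*}

/-- The graph joining every vertex to its image under `f`. -/
def parentGraph (f : V → V) : SimpleGraph V :=
  SimpleGraph.fromRel fun x y => f x = y

/-- `f` is the parent map of a spanning tree of `G` rooted at `r`, and `δ` is its depth function. -/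
structure IsParentMap (G : SimpleGraph V) (r : V) (f : V → V) (δ : V → ℕ) : Prop where
  map_root : f r = r
  depth_root : δ r = 0
  adj : ∀ v, v ≠ r → G.Adj v (f v)
  depth : ∀ v, v ≠ r → δ v = δ (f v) + 1

theorem parentGraph_adj {f : V → V} {x y : V} :
    (parentGraph f).Adj x y ↔ x ≠ y ∧ (f x = y ∨ f y = x) :=
  SimpleGraph.fromRel_adj _ _ _

namespace IsParentMap

variable {G : SimpleGraph V} {r : V} {f : V → V} {δ : V → ℕ}

theorem ne_root (h : IsParentMap G r f δ) {v : V} (hv : 0 < δ v) : v ≠ r := by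
  rintro rfl
  rw [h.depth_root] at hv
  exact lt_irrefl _ hv

theorem pos (h : IsParentMap G r f δ) {v : V} (hv : v ≠ r) : 0 < δ v := by
  rw [h.depth v hv]
  exact Nat.succ_pos _

theorem parentGraph_le (h : IsParentMap G r f δ) : parentGraph f ≤ G := by
  intro x y hxy
  obtain ⟨hne, hf | hf⟩ := parentGraph_adj.1 hxy
  · have hx : x ≠ r := by
      rintro rfl
      exact hne (h.map_root.symm.trans hf)
    exact hf ▸ h.adj x hx
  · have hy : y ≠ r := by
      rintro rfl
      exact hne (hf.symm.trans h.map_root)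
    exact hf ▸ (h.adj y hy).symm

theorem parentGraph_adj_map (h : IsParentMap G r f δ) {v : V} (hv : v ≠ r) :
    (parentGraph f).Adj v (f v) :=
  parentGraph_adj.2 ⟨(h.adj v hv).ne, Or.inl rfl⟩

theorem exists_walk (h : IsParentMap G r f δ) (v : V) :
    ∃ w : (parentGraph f).Walk r v, w.length = δ v := by
  induction hn : δ v generalizing v with
  | zero =>
    have hv : v = r := by
      by_contra hv
      exact absurd (h.pos hv) (by omega)
    subst hv
    exact ⟨.nil, rfl⟩
  | succ n ih =>
    have hv := h.ne_root (v := v) (by omega)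
    obtain ⟨w, hw⟩ := ih (f v) (by have := h.depth v hv; omega)
    exact ⟨w.concat (h.parentGraph_adj_map hv).symm, by simp [hw]⟩

theorem connected (h : IsParentMap G r f δ) : (parentGraph f).Connected := by
  have : Nonempty V := ⟨r⟩
  refine ⟨fun u v => ?_⟩
  obtain ⟨w, -⟩ := h.exists_walk u
  obtain ⟨w', -⟩ := h.exists_walk v
  exact ⟨w.reverse.append w'⟩

theorem depth_le_of_walk (h : IsParentMap G r f δ) {u v : V} (w : (parentGraph f).Walk u v) :
    δ v ≤ δ u + w.length := by
  induction w with
  | nil => simp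
  | @cons a b c hab w ih =>
    rw [SimpleGraph.Walk.length_cons]
    have : δ b ≤ δ a + 1 := by
      obtain ⟨hne, hf | hf⟩ := parentGraph_adj.1 hab
      · by_cases ha : a = r
        · exact absurd (by rw [← hf, ha, h.map_root]) hne
        · have := h.depth a ha
          rw [hf] at this
          omega
      · by_cases hb : b = r
        · rw [hb, h.depth_root]; omega
        · have := h.depth b hb
          rw [hf] at this
          omega
    omega

theorem dist_eq (h : IsParentMap G r f δ) (v : V) : (parentGraph f).dist r v = δ v := by
  refine le_antisymm ?_ ?_
  · obtain ⟨w, hw⟩ := h.exists_walk v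
    exact hw ▸ SimpleGraph.dist_le w
  · obtain ⟨w, hw⟩ := h.connected.exists_walk_length_eq_dist r v
    have := h.depth_le_of_walk w
    rw [h.depth_root] at this
    omega

theorem isTree [Finite V] (h : IsParentMap G r f δ) : (parentGraph f).IsTree := by
  rw [SimpleGraph.isTree_iff_connected_and_card]
  refine ⟨h.connected, le_antisymm ?_ h.connected.card_vert_le_card_edgeSet_add_one⟩
  have hsub : (parentGraph f).edgeSet ⊆ (fun v => s(v, f v)) '' {v | v ≠ r} := by
    intro e
    induction e using Sym2.ind with
    | _ x y =>
      intro he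
      obtain ⟨hne, hf | hf⟩ := parentGraph_adj.1 ((SimpleGraph.mem_edgeSet _).1 he)
      · refine ⟨x, ?_, by simp [hf]⟩
        rintro rfl
        exact hne (h.map_root.symm.trans hf)
      · refine ⟨y, ?_, by simp [hf, Sym2.eq_swap]⟩
        rintro rfl
        exact hne (hf.symm.trans h.map_root)
  have h1 : (parentGraph f).edgeSet.ncard ≤ ({v | v ≠ r} : Set V).ncard :=
    (Set.ncard_le_ncard hsub (Set.toFinite _)).trans (Set.ncard_image_le (Set.toFinite _))
  have h2 : ({v | v ≠ r} : Set V).ncard + 1 = Nat.card V := by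
    have := Set.ncard_add_ncard_compl ({r} : Set V)
    rw [Set.ncard_singleton] at this
    have h3 : ({v | v ≠ r} : Set V) = {r}ᶜ := by ext; simp
    rw [h3]; omega
  rw [Nat.card_coe_set_eq]
  omega

theorem adj_and_depth_iff (h : IsParentMap G r f δ) {x y : V} :
    (parentGraph f).Adj x y ∧ δ y = δ x + 1 ↔ y ≠ r ∧ f y = x := by
  constructor
  · rintro ⟨hadj, hd⟩
    have hy := h.ne_root (v := y) (by omega)
    obtain ⟨hne, hf | hf⟩ := parentGraph_adj.1 hadj
    · have hx : x ≠ r := by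
        rintro rfl
        exact hne (h.map_root.symm.trans hf)
      have := h.depth x hx
      rw [hf] at this
      omega
    · exact ⟨hy, hf⟩
  · rintro ⟨hy, rfl⟩
    exact ⟨(h.parentGraph_adj_map hy).symm, h.depth y hy⟩

theorem depth_iterate (h : IsParentMap G r f δ) (i : ℕ) (v : V) : δ (f^[i] v) = δ v - i := by
  induction i generalizing v with
  | zero => rfl
  | succ i ih =>
    rw [iterate_succ_apply, ih]
    by_cases hv : v = r
    · subst hv
      rw [h.map_root, h.depth_root]
      omega
    · have := h.depth v hv
      omega

theorem eq_root_of_depth_eq_zero (h : IsParentMap G r f δ) {v : V} (hv : δ v = 0) : v = r := by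
  by_contra hne
  exact (h.pos hne).ne' hv

theorem iterate_depth (h : IsParentMap G r f δ) (v : V) : f^[δ v] v = r :=
  h.eq_root_of_depth_eq_zero (by rw [h.depth_iterate, Nat.sub_self])

/-- Any map sending each non-root vertex to a neighbour of smaller rank is a parent map. -/
theorem exists_of_lt {ρ : V → ℕ} (hr : f r = r)
    (hadj : ∀ v, v ≠ r → G.Adj v (f v)) (hlt : ∀ v, v ≠ r → ρ (f v) < ρ v) :
    ∃ δ', IsParentMap G r f δ' := by
  classical
  have key : ∀ n v, ρ v ≤ n → ∃ i, f^[i] v = r := by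
    intro n
    induction n with
    | zero =>
      intro v hv
      by_cases hvr : v = r
      · exact ⟨0, hvr⟩
      · have := hlt v hvr; omega
    | succ n ih =>
      intro v hv
      by_cases hvr : v = r
      · exact ⟨0, hvr⟩
      · obtain ⟨i, hi⟩ := ih (f v) (by have := hlt v hvr; omega)
        exact ⟨i + 1, hi⟩
  have key' : ∀ v, ∃ i, f^[i] v = r := fun v => key _ v le_rfl
  refine ⟨fun v => Nat.find (key' v), hr, by simp, hadj, fun v hv => ?_⟩
  exact Nat.find_comp_succ (key' v) (key' (f v)) hv

theorem iterate_map_root (h : IsParentMap G r f δ) (i : ℕ) : f^[i] r = r :=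
  iterate_fixed h.map_root i

/-- Reparenting `x` to `y`, when `y` is not a descendant of `x`, shifts all descendants of `x`. -/
theorem update [DecidableEq V] (h : IsParentMap G r f δ) {x y : V} (hx : x ≠ r)
    (hxy : G.Adj x y) (hlt : δ x < δ y + 1) (hdesc : ∀ i, f^[i] y ≠ x) :
    ∃ δ', IsParentMap G r (Function.update f x y) δ' ∧ (∀ v, δ v ≤ δ' v) ∧ δ x < δ' x := by
  classical
  have hx0 : ∃ i, f^[i] x = x := ⟨0, rfl⟩
  have hr0 : ¬∃ i, f^[i] r = x := fun ⟨i, hi⟩ => hx ((h.iterate_map_root i).symm.trans hi).symm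
  have hstep : ∀ v, v ≠ x → ((∃ i, f^[i] v = x) ↔ ∃ i, f^[i] (f v) = x) := by
    refine fun v hv => ⟨?_, fun ⟨i, hi⟩ => ⟨i + 1, hi⟩⟩
    rintro ⟨_ | i, hi⟩
    · exact absurd hi hv
    · exact ⟨i, hi⟩
  refine ⟨fun v => if ∃ i, f^[i] v = x then δ v + (δ y + 1 - δ x) else δ v,
    ⟨?_, ?_, ?_, ?_⟩, ?_, ?_⟩
  · rw [update_of_ne hx.symm, h.map_root]
  · simp only [if_neg hr0, h.depth_root]
  · intro v hv
    by_cases hvx : v = x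
    · subst hvx
      rwa [update_self]
    · rw [update_of_ne hvx]
      exact h.adj v hv
  · intro v hv
    by_cases hvx : v = x
    · subst hvx
      rw [update_self, if_pos hx0, if_neg (by simpa using hdesc)]
      omega
    · rw [update_of_ne hvx, h.depth v hv]
      simp only [hstep v hvx]
      split_ifs <;> omega
  · intro v
    dsimp only
    split_ifs <;> omega
  · dsimp only
    rw [if_pos hx0]
    omega

end IsParentMap

/-- A parent map is normal if every edge of `G` joins a vertex to one of its ancestors. -/
structure IsNormalParentMap (G : SimpleGraph V) (r : V) (p : V → V) (δ : V → ℕ) : Prop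
    extends IsParentMap G r p δ where
  normal : ∀ u v, G.Adj u v → δ u ≤ δ v → δ u < δ v ∧ p^[δ v - δ u] v = u

theorem exists_isParentMap [Finite V] {G : SimpleGraph V} (hG : G.Connected) (r : V) :
    ∃ f δ, IsParentMap G r f δ := by
  classical
  have hex : ∀ v, v ≠ r → ∃ u, G.Adj v u ∧ G.dist r u < G.dist r v := by
    intro v hv
    obtain ⟨w, hw⟩ := hG.exists_walk_length_eq_dist v r
    cases w with
    | nil => exact absurd rfl hv
    | @cons _ u _ hadj w =>
      refine ⟨u, hadj, ?_⟩
      rw [SimpleGraph.dist_comm, SimpleGraph.dist_comm (u := r) (v := v), ← hw,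
        SimpleGraph.Walk.length_cons]
      exact Nat.lt_succ_of_le (SimpleGraph.dist_le w)
  choose! g hg using hex
  refine ⟨Function.update g r r, IsParentMap.exists_of_lt (ρ := G.dist r) (update_self ..) ?_ ?_⟩
  · intro v hv
    rw [update_of_ne hv]
    exact (hg v hv).1
  · intro v hv
    rw [update_of_ne hv]
    exact (hg v hv).2

/-- A parent map with the largest possible sum of depths is normal. -/
theorem exists_isNormalParentMap [Fintype V] {G : SimpleGraph V} (hG : G.Connected) (r : V) :
    ∃ p δ, IsNormalParentMap G r p δ := by
  classical
  obtain ⟨f₀, hf₀⟩ := exists_isParentMap hG r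
  have : Nonempty {f : V → V // ∃ δ, IsParentMap G r f δ} := ⟨⟨f₀, hf₀⟩⟩
  obtain ⟨⟨p, δ, h⟩, hmax⟩ := Finite.exists_max
    fun f : {f : V → V // ∃ δ, IsParentMap G r f δ} => ∑ v, (parentGraph f.1).dist r v
  have key : ∀ x y, x ≠ r → G.Adj x y → δ x < δ y + 1 → ∃ i, p^[i] y = x := by
    intro x y hx hxy hlt
    by_contra! hdesc
    obtain ⟨δ', h', hle, hlt'⟩ := h.update hx hxy hlt hdesc
    refine (hmax ⟨_, δ', h'⟩).not_gt ?_
    simp only [h.dist_eq, h'.dist_eq]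
    exact sum_lt_sum (fun v _ => hle v) ⟨x, mem_univ x, hlt'⟩
  refine ⟨p, δ, h, fun u v huv hle => ?_⟩
  have hanc : ∃ i, p^[i] v = u := by
    by_cases hu : u = r
    · exact ⟨δ v, by rw [h.iterate_depth, hu]⟩
    · exact key u v hu huv (by omega)
  obtain ⟨i, hi⟩ := hanc
  have hd := h.depth_iterate i v
  rw [hi] at hd
  have hi0 : i ≠ 0 := by
    rintro rfl
    exact huv.ne hi.symm
  by_cases hv : δ v = 0
  · have hvr := h.eq_root_of_depth_eq_zero hv
    subst hvr
    rw [h.iterate_map_root] at hi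
    exact absurd hi.symm huv.ne
  · refine ⟨by omega, ?_⟩
    by_cases hiv : i ≤ δ v
    · rwa [show δ v - δ u = i by omega]
    · rw [show δ v - δ u = δ v by omega, h.iterate_depth]
      exact (h.eq_root_of_depth_eq_zero (by omega)).symm

theorem dist_iso {T T' : SimpleGraph V} (φ : T ≃g T') (u v : V) :
    T'.dist (φ u) (φ v) = T.dist u v := by
  have hle : ∀ {T T' : SimpleGraph V} (φ : T ≃g T') (u v : V), T.Reachable u v →
      T'.dist (φ u) (φ v) ≤ T.dist u v := by
    intro T T' φ u v h
    obtain ⟨w, hw⟩ := h.exists_walk_length_eq_dist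
    rw [← hw, ← SimpleGraph.Walk.length_map φ.toHom w]
    exact SimpleGraph.dist_le _
  by_cases h : T.Reachable u v
  · refine le_antisymm (hle φ u v h) ?_
    have := hle φ.symm (φ u) (φ v) (φ.reachable_iff.2 h)
    simpa using this
  · rw [SimpleGraph.dist_eq_zero_of_not_reachable h,
      SimpleGraph.dist_eq_zero_of_not_reachable (mt φ.reachable_iff.1 h)]

section Invariants

variable [Fintype V]

open scoped Classical in
/-- The number of vertices at each distance from `r`. -/
noncomputable def depthProfile (T : SimpleGraph V) (r : V) (j : ℕ) : ℕ :=
  #{x | T.dist r x = j}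

open scoped Classical in
/-- The distances from `r` to the vertices that do not have exactly one child. -/
noncomputable def specialDepths (T : SimpleGraph V) (r : V) : Finset ℕ :=
  image (T.dist r) {x | #{y | T.Adj x y ∧ T.dist r y = T.dist r x + 1} ≠ 1}

theorem depthProfile_iso {T T' : SimpleGraph V} (φ : T ≃g T') (r : V) :
    depthProfile T r = depthProfile T' (φ r) := by
  classical
  funext j
  refine card_equiv φ.toEquiv fun x => ?_
  simp [dist_iso φ]

theorem specialDepths_iso {T T' : SimpleGraph V} (φ : T ≃g T') (r : V) :
    specialDepths T r = specialDepths T' (φ r) := by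
  classical
  have hcard : ∀ x, #{y | T.Adj x y ∧ T.dist r y = T.dist r x + 1} =
      #{y | T'.Adj (φ x) y ∧ T'.dist (φ r) y = T'.dist (φ r) (φ x) + 1} := by
    intro x
    refine card_equiv φ.toEquiv fun y => ?_
    simp [dist_iso φ, φ.map_adj_iff]
  ext j
  simp only [specialDepths, mem_image, mem_filter_univ]
  constructor
  · rintro ⟨x, hx, rfl⟩
    exact ⟨φ x, by rwa [← hcard], dist_iso φ r x⟩
  · rintro ⟨x, hx, rfl⟩
    obtain ⟨x, rfl⟩ := φ.surjective x
    exact ⟨x, by rwa [hcard], (dist_iso φ r x).symm⟩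

open scoped Classical in
/-- A rooted isomorphism invariant taking many values on a family of graphs forces many isomorphism
classes in that family. -/
theorem exists_pairwise_nonisomorphic {β : Type*} [DecidableEq β] (I : SimpleGraph V → V → β)
    (hI : ∀ (T T' : SimpleGraph V) (φ : T ≃g T') (v : V), I T v = I T' (φ v))
    (F : Finset (SimpleGraph V)) (r : V) :
    ∃ S ⊆ F, (∀ T ∈ S, ∀ T' ∈ S, T ≠ T' → IsEmpty (T ≃g T')) ∧
      #(F.image fun T => I T r) ≤ Fintype.card V * #S := by
  obtain ⟨S, hS, hmax⟩ := exists_max_image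
    {S ∈ F.powerset | ∀ T ∈ S, ∀ T' ∈ S, T ≠ T' → IsEmpty (T ≃g T')} card
    ⟨∅, by simp⟩
  simp only [mem_filter, mem_powerset] at hS hmax
  refine ⟨S, hS.1, hS.2, ?_⟩
  have hrep : ∀ T ∈ F, ∃ T' ∈ S, Nonempty (T ≃g T') := by
    intro T hT
    by_contra! hne
    have hTS : T ∉ S := fun h => (hne T h).false (SimpleGraph.Iso.refl)
    have := hmax (insert T S) ⟨insert_subset hT hS.1, ?_⟩
    · rw [card_insert_of_notMem hTS] at this
      omega
    · intro A hA B hB hAB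
      rw [mem_insert] at hA hB
      rcases hA with rfl | hA <;> rcases hB with rfl | hB
      · exact absurd rfl hAB
      · exact hne B hB
      · exact ⟨fun φ => (hne A hA).false φ.symm⟩
      · exact hS.2 A hA B hB hAB
  calc #(F.image fun T => I T r)
      ≤ #(((univ : Finset V) ×ˢ S).image fun x => I x.2 x.1) := by
        refine card_le_card fun b hb => ?_
        obtain ⟨T, hT, rfl⟩ := mem_image.1 hb
        obtain ⟨T', hT', ⟨φ⟩⟩ := hrep T hT
        exact mem_image.2 ⟨(φ r, T'), by simp [hT'], (hI T T' φ r).symm⟩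
    _ ≤ #((univ : Finset V) ×ˢ S) := card_image_le
    _ = Fintype.card V * #S := by rw [card_product, card_univ]

open scoped Classical in
/-- The children of `x` for the parent map `f`. -/
noncomputable def children (r : V) (f : V → V) (x : V) : Finset V :=
  {y | y ≠ r ∧ f y = x}

theorem mem_children {r : V} {f : V → V} {x y : V} :
    y ∈ children r f x ↔ y ≠ r ∧ f y = x := by
  simp [children]

open scoped Classical in
theorem sum_card_children (r : V) (f : V → V) :
    ∑ x, #(children r f x) + 1 = Fintype.card V := by
  have h := card_eq_sum_card_fiberwise (s := univ.erase r) (t := univ) (f := f)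
    (fun _ _ => by simp)
  have hc : #((univ : Finset V).erase r) + 1 = Fintype.card V := by
    rw [card_erase_add_one (mem_univ r), card_univ]
  rw [← hc, h]
  congr 1
  refine sum_congr rfl fun x _ => congrArg card ?_
  ext y
  simp [mem_children]

open scoped Classical in
/-- There are at most twice as many children of branching vertices as childless vertices. -/
theorem sum_card_children_branching (r : V) (f : V → V) :
    ∑ x with 2 ≤ #(children r f x), #(children r f x) ≤ 2 * #{x | children r f x = ∅} := by
  have h := sum_card_children r f
  have h1 : ∑ x, (if 2 ≤ #(children r f x) then #(children r f x) else 0) + 2 * Fintype.card V ≤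
      2 * ∑ x, (if children r f x = ∅ then 1 else 0) + 2 * ∑ x, #(children r f x) := by
    rw [← card_univ, card_eq_sum_ones, mul_sum, mul_sum, mul_sum, ← sum_add_distrib,
      ← sum_add_distrib]
    refine sum_le_sum fun x _ => ?_
    by_cases hx : children r f x = ∅
    · simp [hx]
    · have := card_pos.2 (nonempty_iff_ne_empty.2 hx)
      rw [if_neg hx]
      split_ifs <;> omega
  rw [sum_filter, card_filter]
  omega

open scoped Classical in
theorem card_not_single_child_le (r : V) (f : V → V) :
    #{x | #(children r f x) ≠ 1} ≤ 2 * #{x | children r f x = ∅} := by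
  have h := sum_card_children_branching r f
  have h1 : #{x | 2 ≤ #(children r f x)} * 2 ≤
      ∑ x with 2 ≤ #(children r f x), #(children r f x) := by
    rw [← smul_eq_mul]
    exact card_nsmul_le_sum _ _ _ fun x hx => (mem_filter.1 hx).2
  have h2 : #{x | #(children r f x) ≠ 1} ≤
      #{x | children r f x = ∅} + #{x | 2 ≤ #(children r f x)} := by
    refine (card_le_card fun x hx => ?_).trans (card_union_le _ _)
    simp only [mem_union, mem_filter_univ, ← card_eq_zero] at hx ⊢
    omega
  omega

namespace IsParentMap

variable {G : SimpleGraph V} {r : V} {f : V → V} {δ : V → ℕ}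

open scoped Classical in
theorem depthProfile_eq (h : IsParentMap G r f δ) :
    depthProfile (parentGraph f) r = fun j => #{x | δ x = j} := by
  funext j
  simp [depthProfile, h.dist_eq]

open scoped Classical in
theorem specialDepths_eq (h : IsParentMap G r f δ) :
    specialDepths (parentGraph f) r = image δ {x | #(children r f x) ≠ 1} := by
  simp [specialDepths, h.dist_eq, h.adj_and_depth_iff, children, funext h.dist_eq]

end IsParentMap

end Invariants

section Histogram

variable {ι α : Type*} [DecidableEq ι] [DecidableEq α]

/-- Choosing one of two elements from each of many disjoint pairs gives many histograms. -/
theorem exists_histograms_of_pairwiseDisjoint {X Y : Finset ι} {a b : ι → α} (hYX : Y ⊆ X)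
    (hab : ∀ x ∈ Y, a x ≠ b x)
    (hdisj : (Y : Set ι).PairwiseDisjoint fun x => ({a x, b x} : Finset α)) :
    ∃ F : Finset (α → ℕ), 2 ^ #Y ≤ #F ∧ ∀ h ∈ F, ∃ g : ι → α,
      (∀ x, g x = a x ∨ g x = b x) ∧ ∀ c, h c = #{x ∈ X | g x = c} := by
  classical
  let g : Finset ι → ι → α := fun s x => if x ∈ s then a x else b x
  have hcount : ∀ s ⊆ Y, ∀ x ∈ Y, #{x' ∈ X | g s x' = a x} =
      #{x' ∈ X \ Y | b x' = a x} + if x ∈ s then 1 else 0 := by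
    intro s hs x hx
    have hX : X = X \ Y ∪ Y := (sdiff_union_of_subset hYX).symm
    rw [hX, filter_union, card_union_of_disjoint (disjoint_filter_filter disjoint_sdiff_self_left),
      ← hX]
    congr 1
    · refine congrArg card (filter_congr fun x' hx' => ?_)
      have : x' ∉ s := fun h => (mem_sdiff.1 hx').2 (hs h)
      simp [g, this]
    · have : {x' ∈ Y | g s x' = a x} = if x ∈ s then {x} else ∅ := by
        ext x'
        have hne : x' ∈ Y → x' ≠ x → g s x' ≠ a x := by
          intro hx' hne heq
          refine Finset.disjoint_left.1 (hdisj hx' hx hne) (?_ : a x ∈ _) (by simp)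
          rw [← heq]
          simp only [g]
          split_ifs <;> simp
        by_cases hxx : x' = x
        · subst hxx
          by_cases hxs : x' ∈ s
          · simp [g, hxs, hx]
          · simp [g, hxs, (hab x' hx).symm]
        · split_ifs <;> simp [hxx] <;> exact fun h => hne h hxx
      rw [this]
      split_ifs <;> simp
  refine ⟨Y.powerset.image fun s c => #{x ∈ X | g s x = c}, ?_, ?_⟩
  · rw [card_image_of_injOn, card_powerset]
    intro s hs s' hs' heq
    rw [mem_coe, mem_powerset] at hs hs'
    ext x
    by_cases hx : x ∈ Y
    · have := congrFun heq (a x)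
      dsimp only at this
      rw [hcount s hs x hx, hcount s' hs' x hx] at this
      split_ifs at this <;> simp_all
    · exact ⟨fun h => absurd (hs h) hx, fun h => absurd (hs' h) hx⟩
  · intro h hh
    obtain ⟨s, -, rfl⟩ := mem_image.1 hh
    refine ⟨g s, fun x => ?_, fun c => rfl⟩
    simp only [g]
    split_ifs <;> simp

/-- A family of sets in which no element is popular contains many disjoint pairs. -/
theorem exists_pairwiseDisjoint_pairs {X : Finset ι} {D : ι → Finset α} {Q : ℕ} (a b : ι → α)
    (ha : ∀ x ∈ X, a x ∈ D x) (hb : ∀ x ∈ X, b x ∈ D x) (hQ : ∀ c, #{x ∈ X | c ∈ D x} ≤ Q) :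
    ∃ Y ⊆ X, (Y : Set ι).PairwiseDisjoint (fun x => ({a x, b x} : Finset α)) ∧
      #X ≤ 2 * #Y * Q := by
  classical
  obtain ⟨Y, hY, hmax⟩ := exists_max_image
    (X.powerset.filter fun Y : Finset ι =>
      (Y : Set ι).PairwiseDisjoint fun x => ({a x, b x} : Finset α)) card
    ⟨∅, by simp⟩
  simp only [mem_filter, mem_powerset] at hY hmax
  refine ⟨Y, hY.1, hY.2, ?_⟩
  have hmeet : ∀ x ∈ X, ∃ y ∈ Y, ¬Disjoint ({a x, b x} : Finset α) {a y, b y} := by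
    intro x hx
    by_contra! hne
    have hxY : x ∉ Y := fun h => by simpa using hne x h
    have := hmax (insert x Y) ⟨insert_subset hx hY.1, ?_⟩
    · rw [card_insert_of_notMem hxY] at this
      omega
    · rw [coe_insert]
      exact hY.2.insert fun y hy _ => hne y hy
  calc #X ≤ #((Y.biUnion fun y => {a y, b y}).biUnion fun c => {x ∈ X | c ∈ D x}) := by
        refine card_le_card fun x hx => ?_
        obtain ⟨y, hy, hxy⟩ := hmeet x hx
        obtain ⟨c, hc, hc'⟩ := not_disjoint_iff.1 hxy
        refine mem_biUnion.2 ⟨c, mem_biUnion.2 ⟨y, hy, hc'⟩, mem_filter.2 ⟨hx, ?_⟩⟩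
        rw [mem_insert, mem_singleton] at hc
        rcases hc with rfl | rfl
        exacts [ha x hx, hb x hx]
    _ ≤ #(Y.biUnion fun y => ({a y, b y} : Finset α)) * Q :=
        card_biUnion_le_card_mul _ _ _ fun c _ => hQ c
    _ ≤ #Y * 2 * Q := Nat.mul_le_mul_right _ (card_biUnion_le_card_mul _ _ _ fun _ _ => card_le_two)
    _ = 2 * #Y * Q := by ring

/-- The number of histograms of choice functions of a large family of sets of size `k + 1`. -/
theorem exists_histograms (L k : ℕ) (X : Finset ι) (D : ι → Finset α)
    (hD : ∀ x ∈ X, k + 1 ≤ #(D x)) (hX : (k + 1) ^ 2 * ((L + 1) * 2 ^ L) ≤ #X) :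
    ∃ F : Finset (α → ℕ), 2 ^ (L * k) ≤ #F ∧ ∀ h ∈ F, ∃ g : ι → α,
      (∀ x ∈ X, g x ∈ D x) ∧ ∀ c, h c = #{x ∈ X | g x = c} := by
  classical
  induction k generalizing X D with
  | zero =>
    have : Nonempty α := by
      have hpos : 0 < #X := lt_of_lt_of_le (by positivity) hX
      obtain ⟨x, hx⟩ := card_pos.1 hpos
      obtain ⟨c, -⟩ := card_pos.1 (hD x hx)
      exact ⟨c⟩
    have hg : ∀ x ∈ X, ∃ c, c ∈ D x := fun x hx => card_pos.1 (hD x hx)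
    choose! g hg using hg
    exact ⟨{fun c => #{x ∈ X | g x = c}}, by simp, by simpa using ⟨g, hg, fun _ => rfl⟩⟩
  | succ k ih =>
    by_cases hpop : ∃ c, 2 ^ L ≤ #{x ∈ X | c ∈ D x}
    · obtain ⟨c, hc⟩ := hpop
      have hP : ∀ j, ∃ P ⊆ X, j < 2 ^ L → (#P = j ∧ ∀ x ∈ P, c ∈ D x) := by
        intro j
        by_cases hj : j < 2 ^ L
        · obtain ⟨P, hP, hPj⟩ := exists_subset_card_eq (hj.le.trans hc)
          exact ⟨P, hP.trans (filter_subset _ _), fun _ =>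
            ⟨hPj, fun x hx => (mem_filter.1 (hP hx)).2⟩⟩
        · exact ⟨∅, empty_subset _, fun h => absurd h hj⟩
      choose P hPX hP using hP
      have hF : ∀ j, ∃ F : Finset (α → ℕ), j < 2 ^ L → (2 ^ (L * k) ≤ #F ∧ ∀ h ∈ F, ∃ g : ι → α,
          (∀ x ∈ X \ P j, g x ∈ (D x).erase c) ∧ ∀ b, h b = #{x ∈ X \ P j | g x = b}) := by
        intro j
        by_cases hj : j < 2 ^ L
        · have hD' : ∀ x ∈ X \ P j, k + 1 ≤ #((D x).erase c) := by
            intro x hx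
            have := hD x (mem_sdiff.1 hx).1
            have := pred_card_le_card_erase (s := D x) (a := c)
            omega
          have hX' : (k + 1) ^ 2 * ((L + 1) * 2 ^ L) ≤ #(X \ P j) := by
            rw [card_sdiff_of_subset (hPX j), (hP j hj).1]
            have : (k + 1) ^ 2 * ((L + 1) * 2 ^ L) + 2 ^ L ≤
                (k + 1 + 1) ^ 2 * ((L + 1) * 2 ^ L) := by
              have : 2 ^ L ≤ (L + 1) * 2 ^ L := Nat.le_mul_of_pos_left _ (by omega)
              nlinarith [Nat.zero_le (k * ((L + 1) * 2 ^ L))]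
            omega
          obtain ⟨F, hF⟩ := ih _ _ hD' hX'
          exact ⟨F, fun _ => hF⟩
        · exact ⟨∅, fun h => absurd h hj⟩
      choose F hF using hF
      have hF0 : ∀ j < 2 ^ L, ∀ h ∈ F j, h c = 0 := by
        intro j hj h hh
        obtain ⟨g, hg, hgh⟩ := (hF j hj).2 h hh
        rw [hgh, card_eq_zero, filter_eq_empty_iff]
        exact fun x hx => ne_of_mem_erase (hg x hx)
      refine ⟨((range (2 ^ L)).sigma F).image fun x => update x.2 c x.1, ?_, ?_⟩
      · rw [card_image_of_injOn, card_sigma]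
        · calc 2 ^ (L * (k + 1)) = #(range (2 ^ L)) • 2 ^ (L * k) := by
                rw [card_range, smul_eq_mul]; ring
            _ ≤ _ := card_nsmul_le_sum _ _ _ fun j hj => (hF j (mem_range.1 hj)).1
        · rintro ⟨j, h⟩ hj ⟨j', h'⟩ hj' heq
          simp only [coe_sigma, Set.mem_sigma_iff, mem_coe, mem_range] at hj hj' heq
          have hjj : j = j' := by simpa using congrFun heq c
          subst hjj
          congr 1
          funext b
          by_cases hb : b = c
          · subst hb
            rw [hF0 j hj.1 h hj.2, hF0 j hj.1 h' hj'.2]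
          · simpa [hb] using congrFun heq b
      · intro h' hh'
        obtain ⟨⟨j, h⟩, hj, rfl⟩ := mem_image.1 hh'
        simp only [mem_sigma, mem_range] at hj
        obtain ⟨g, hg, hgh⟩ := (hF j hj.1).2 h hj.2
        refine ⟨fun x => if x ∈ P j then c else g x, fun x hx => ?_, fun b => ?_⟩
        · dsimp only
          split_ifs with hxP
          · exact (hP j hj.1).2 x hxP
          · exact mem_of_mem_erase (hg x (mem_sdiff.2 ⟨hx, hxP⟩))
        · have hXP : X = X \ P j ∪ P j := (sdiff_union_of_subset (hPX j)).symm
          have h1 : {x ∈ X \ P j | (if x ∈ P j then c else g x) = b} = {x ∈ X \ P j | g x = b} :=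
            filter_congr fun x hx => by rw [if_neg (mem_sdiff.1 hx).2]
          have h2 : {x ∈ P j | (if x ∈ P j then c else g x) = b} = {x ∈ P j | c = b} :=
            filter_congr fun x hx => by rw [if_pos hx]
          rw [hXP, filter_union,
            card_union_of_disjoint (disjoint_filter_filter disjoint_sdiff_self_left), h1, h2,
            ← hgh]
          by_cases hb : b = c
          · subst hb
            simp [hF0 j hj.1 h hj.2, (hP j hj.1).1]
          · simp [hb, Ne.symm hb]
    · push Not at hpop
      have hpair : ∀ x ∈ X, ∃ a b, a ∈ D x ∧ b ∈ D x ∧ a ≠ b := by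
        intro x hx
        obtain ⟨a, ha, b, hb, hne⟩ := one_lt_card.1 (by have := hD x hx; omega : 1 < #(D x))
        exact ⟨a, b, ha, hb, hne⟩
      have : Nonempty α := by
        have hpos : 0 < #X := lt_of_lt_of_le (by positivity) hX
        obtain ⟨x, hx⟩ := card_pos.1 hpos
        obtain ⟨c, -⟩ := hpair x hx
        exact ⟨c⟩
      choose! a b ha hb hab using hpair
      obtain ⟨Y, hYX, hdisj, hcard⟩ :=
        exists_pairwiseDisjoint_pairs a b ha hb fun c => (hpop c).le
      obtain ⟨F, hF, hFg⟩ := exists_histograms_of_pairwiseDisjoint hYX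
        (fun x hx => hab x (hYX hx)) hdisj
      refine ⟨F, (Nat.pow_le_pow_right (by norm_num) ?_).trans hF, fun h hh => ?_⟩
      · have h1 : (k + 2) ^ 2 * (L + 1) * 2 ^ L ≤ 2 * #Y * 2 ^ L := by
          refine le_trans (le_of_eq ?_) (hX.trans hcard)
          ring
        have h2 := Nat.le_of_mul_le_mul_right h1 (by positivity)
        nlinarith [Nat.zero_le (k * L)]
      · obtain ⟨g, hg, hgh⟩ := hFg h hh
        refine ⟨g, fun x hx => ?_, hgh⟩
        rcases hg x with h | h <;> rw [h]
        exacts [ha x hx, hb x hx]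

end Histogram
namespace IsNormalParentMap

variable {G : SimpleGraph V} {r : V} {p : V → V} {δ : V → ℕ}

theorem eq_of_depth_eq (h : IsNormalParentMap G r p δ) {u u' v : V} (hu : G.Adj u v)
    (hu' : G.Adj u' v) (hle : δ u ≤ δ v) (heq : δ u = δ u') : u = u' := by
  rw [← (h.normal u v hu hle).2, ← (h.normal u' v hu' (heq ▸ hle)).2, heq]

/-- Depths for a modified parent map, relative to the nearest modified ancestor. -/
theorem exists_depth_shift (h : IsNormalParentMap G r p δ) {f : V → V} {δ' : V → ℕ}
    (h' : IsParentMap G r f δ') (K : Finset V) (hf : ∀ v ∉ K, f v = p v) (x : V) :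
    ∃ t, (t = r ∨ t ∈ K) ∧ δ t ≤ δ x ∧ δ' x = δ' t + (δ x - δ t) := by
  induction hn : δ x generalizing x with
  | zero =>
    obtain rfl := h.eq_root_of_depth_eq_zero hn
    exact ⟨x, Or.inl rfl, by omega, by simp [hn]⟩
  | succ n ih =>
    by_cases hxK : x ∈ K
    · exact ⟨x, Or.inr hxK, by omega, by simp [hn]⟩
    · have hx : x ≠ r := h.ne_root (by omega)
      have hd := h.depth x hx
      have hd' := h'.depth x hx
      rw [hf x hxK] at hd'
      obtain ⟨t, ht, hle, heq⟩ := ih (p x) (by omega)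
      exact ⟨t, ht, by omega, by omega⟩

end IsNormalParentMap

section Families

variable [Fintype V] {G : SimpleGraph V} {r : V} {p : V → V} {δ : V → ℕ}

open scoped Classical in
/-- A family of parent maps on which a rooted invariant has small fibres yields many pairwise
non-isomorphic spanning trees. -/
theorem exists_spanningTrees_of_fibers {ι β : Type*} [DecidableEq β] (I : SimpleGraph V → V → β)
    (hI : ∀ (T T' : SimpleGraph V) (φ : T ≃g T') (v : V), I T v = I T' (φ v))
    (J : Finset ι) (f : ι → V → V) (hf : ∀ i ∈ J, ∃ δ, IsParentMap G r (f i) δ) (M : ℕ)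
    (hM : ∀ b, #{i ∈ J | I (parentGraph (f i)) r = b} ≤ M) :
    ∃ S : Finset (SimpleGraph V), (∀ T ∈ S, T ≤ G ∧ T.IsTree) ∧
      (∀ T ∈ S, ∀ T' ∈ S, T ≠ T' → IsEmpty (T ≃g T')) ∧
      #J ≤ M * (Fintype.card V * #S) := by
  obtain ⟨S, hS, hpair, hcard⟩ :=
    exists_pairwise_nonisomorphic I hI (J.image fun i => parentGraph (f i)) r
  refine ⟨S, fun T hT => ?_, hpair, ?_⟩
  · obtain ⟨i, hi, rfl⟩ := mem_image.1 (hS hT)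
    obtain ⟨δ, h⟩ := hf i hi
    exact ⟨h.parentGraph_le, h.isTree⟩
  · rw [image_image] at hcard
    exact (card_le_mul_card_image (f := fun i => I (parentGraph (f i)) r) J M
      fun b _ => hM b).trans (Nat.mul_le_mul_left _ hcard)

namespace IsNormalParentMap

theorem iterate_mem_children (h : IsNormalParentMap G r p δ) {u v : V} (huv : G.Adj u v)
    (hlt : δ u < δ v) : p^[δ v - δ u - 1] v ∈ children r p u := by
  refine mem_children.2 ⟨h.ne_root ?_, ?_⟩
  · rw [h.depth_iterate]
    omega
  · rw [← iterate_succ_apply' p, Nat.succ_eq_add_one, show δ v - δ u - 1 + 1 = δ v - δ u by omega]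
    exact (h.normal u v huv hlt.le).2

open scoped Classical in
/-- Many leaves of a normal tree can be reattached to their ancestors in many different ways. -/
theorem exists_spanningTrees_of_leaves (h : IsNormalParentMap G r p δ) {k L : ℕ}
    (hdeg : ∀ v, k + 1 ≤ #{u | G.Adj u v})
    (hX : (k + 1) ^ 2 * ((L + 1) * 2 ^ L) ≤ #{x | x ≠ r ∧ children r p x = ∅}) :
    ∃ S : Finset (SimpleGraph V), (∀ T ∈ S, T ≤ G ∧ T.IsTree) ∧
      (∀ T ∈ S, ∀ T' ∈ S, T ≠ T' → IsEmpty (T ≃g T')) ∧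
      2 ^ (L * k) ≤ Fintype.card V * #S := by
  set X : Finset V := {x | x ≠ r ∧ children r p x = ∅} with hXdef
  have memX : ∀ x, x ∈ X ↔ x ≠ r ∧ children r p x = ∅ := fun x => by simp [hXdef]
  have hlt : ∀ x ∈ X, ∀ u, G.Adj u x → δ u < δ x := by
    intro x hx u hu
    by_contra! hle
    have := h.iterate_mem_children hu.symm (h.normal x u hu.symm hle).1
    rw [((memX x).1 hx).2] at this
    exact notMem_empty _ this
  obtain ⟨F, hF, hFg⟩ := exists_histograms L k X (fun x => ({u | G.Adj u x} : Finset V).image δ)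
    (fun x hx => by
      rw [card_image_of_injOn]
      · exact hdeg x
      · intro u hu u' hu' heq
        simp only [coe_filter_univ, Set.mem_ofPred_eq] at hu hu'
        exact h.eq_of_depth_eq hu hu' (hlt x hx u hu).le heq) hX
  have hmap : ∀ hist ∈ F, ∃ f, (∃ δ', IsParentMap G r f δ') ∧
      ∀ j, depthProfile (parentGraph f) r (j + 1) = #{v ∈ Xᶜ | δ v = j + 1} + hist j := by
    intro hist hh
    obtain ⟨g, hg, hgh⟩ := hFg hist hh
    have hu : ∀ x ∈ X, ∃ u, G.Adj u x ∧ δ u = g x := by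
      intro x hx
      simpa using hg x hx
    choose! u hu hug using hu
    have hf : IsParentMap G r (fun v => if v ∈ X then u v else p v)
        (fun v => if v ∈ X then g v + 1 else δ v) := by
      have hr : r ∉ X := fun hr => ((memX r).1 hr).1 rfl
      refine ⟨by simp [hr, h.map_root], by simp [hr, h.depth_root], fun v hv => ?_, fun v hv => ?_⟩
      · split_ifs with hvX
        · exact (hu v hvX).symm
        · exact h.adj v hv
      · by_cases hvX : v ∈ X
        · have huX : u v ∉ X := by
            intro hmem
            have := h.iterate_mem_children (hu v hvX) (hlt v hvX _ (hu v hvX))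
            rw [((memX _).1 hmem).2] at this
            exact notMem_empty _ this
          simp only [if_pos hvX, if_neg huX, hug v hvX]
        · have hpX : p v ∉ X := by
            intro hmem
            have : v ∈ children r p (p v) := mem_children.2 ⟨hv, rfl⟩
            rw [((memX _).1 hmem).2] at this
            exact notMem_empty _ this
          simp only [if_neg hvX, if_neg hpX, h.depth v hv]
    refine ⟨_, ⟨_, hf⟩, fun j => ?_⟩
    rw [hf.depthProfile_eq, hgh]
    dsimp only
    rw [← union_compl X, filter_union, card_union_of_disjoint
      (disjoint_filter_filter disjoint_compl_right), add_comm]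
    congr 2
    · exact filter_congr fun v hv => by rw [if_neg (mem_compl.1 hv)]
    · exact filter_congr fun v hv => by rw [if_pos hv, Nat.add_right_cancel_iff]
  have : Nonempty V := ⟨r⟩
  choose! f hf hprof using hmap
  obtain ⟨S, hS, hpair, hcard⟩ := exists_spanningTrees_of_fibers depthProfile
    (fun _ _ φ v => depthProfile_iso φ v) F f hf 1 fun b => by
      refine card_le_one.2 fun x hx y hy => ?_
      rw [mem_filter] at hx hy
      funext j
      have h1 := hprof x hx.1 j
      have h2 := hprof y hy.1 j
      rw [hx.2] at h1
      rw [hy.2] at h2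
      omega
  exact ⟨S, hS, hpair, by omega⟩

end IsNormalParentMap

open scoped Classical in
theorem card_childless_le {f : V → V} (K : Finset V) (hf : ∀ v ∉ K, f v = p v) :
    #{x | children r f x = ∅} ≤ #{x | children r p x = ∅} + #K := by
  calc #{x | children r f x = ∅} ≤ #(({x | children r p x = ∅} : Finset V) ∪ K.image p) := by
        refine card_le_card fun x hx => ?_
        rw [mem_filter_univ] at hx
        rw [mem_union, mem_filter_univ, mem_image]
        by_contra! hne
        obtain ⟨y, hy⟩ := hne.1
        rw [mem_children] at hy
        have hyK : y ∉ K := fun hyK => hne.2 y hyK hy.2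
        have : y ∈ children r f x := mem_children.2 ⟨hy.1, (hf y hyK).trans hy.2⟩
        rw [hx] at this
        exact notMem_empty _ this
    _ ≤ _ := (card_union_le _ _).trans (Nat.add_le_add_left card_image_le _)

open scoped Classical in
theorem IsParentMap.card_specialDepths_le {f : V → V} {δ' : V → ℕ} (h : IsParentMap G r f δ')
    (K : Finset V) (hf : ∀ v ∉ K, f v = p v) :
    #(specialDepths (parentGraph f) r) ≤ 2 * (#{x | children r p x = ∅} + #K) := by
  rw [h.specialDepths_eq]
  refine card_image_le.trans ((card_not_single_child_le r f).trans ?_)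
  exact Nat.mul_le_mul_left _ (card_childless_le K hf)

theorem IsParentMap.mem_specialDepths_of_two {f : V → V} {δ' : V → ℕ} (h : IsParentMap G r f δ')
    {x y y' : V} (hne : y ≠ y') (hy : y ∈ children r f x) (hy' : y' ∈ children r f x) :
    δ' x ∈ specialDepths (parentGraph f) r := by
  classical
  rw [h.specialDepths_eq]
  refine mem_image_of_mem _ ?_
  rw [mem_filter_univ]
  exact (one_lt_card.2 ⟨y, hy, y', hy', hne⟩).ne'

theorem IsParentMap.mem_specialDepths_of_empty {f : V → V} {δ' : V → ℕ} (h : IsParentMap G r f δ')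
    {x : V} (hx : children r f x = ∅) : δ' x ∈ specialDepths (parentGraph f) r := by
  classical
  rw [h.specialDepths_eq]
  refine mem_image_of_mem _ ?_
  rw [mem_filter_univ, hx, card_empty]
  exact zero_ne_one

namespace IsNormalParentMap

open scoped Classical in
/-- Reattaching a few fixed vertices, each of which has many neighbours among its ancestors. -/
theorem exists_spanningTrees_of_large_updegree (h : IsNormalParentMap G r p δ) (K : Finset V)
    (hr : r ∉ K) (U : V → Finset V) {q s : ℕ}
    (hU : ∀ w ∈ K, ∀ u ∈ U w, G.Adj u w ∧ δ u < δ w ∧ u ∉ K.image p) (hq : ∀ w ∈ K, q ≤ #(U w))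
    (hs : 2 * (#{x | children r p x = ∅} + #K) ≤ s) :
    ∃ S : Finset (SimpleGraph V), (∀ T ∈ S, T ≤ G ∧ T.IsTree) ∧
      (∀ T ∈ S, ∀ T' ∈ S, T ≠ T' → IsEmpty (T ≃g T')) ∧
      q ^ #K ≤ ((#K + 1) * (s * (s + 1))) ^ #K * (Fintype.card V * #S) := by
  have hprod : ∀ (A : V → Finset V),
      #(Fintype.piFinset fun v => if v ∈ K then A v else {p v}) = ∏ w ∈ K, #(A w) := by
    intro A
    rw [Fintype.card_piFinset, ← prod_subset (subset_univ K)]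
    · exact prod_congr rfl fun w hw => by rw [if_pos hw]
    · intro v _ hv
      rw [if_neg hv, card_singleton]
  set J := Fintype.piFinset fun v => if v ∈ K then U v else {p v} with hJ
  have hJK : ∀ g ∈ J, ∀ w ∈ K, g w ∈ U w := by
    intro g hg w hw
    simpa [hw] using Fintype.mem_piFinset.1 hg w
  have hJp : ∀ g ∈ J, ∀ v ∉ K, g v = p v := by
    intro g hg v hv
    simpa [hv] using Fintype.mem_piFinset.1 hg v
  have hpar : ∀ g ∈ J, ∃ δ', IsParentMap G r g δ' := by
    intro g hg
    refine IsParentMap.exists_of_lt (ρ := δ) ((hJp g hg r hr).trans h.map_root) ?_ ?_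
    · intro v hv
      by_cases hvK : v ∈ K
      · exact (hU v hvK _ (hJK g hg v hvK)).1.symm
      · rw [hJp g hg v hvK]
        exact h.adj v hv
    · intro v hv
      by_cases hvK : v ∈ K
      · exact (hU v hvK _ (hJK g hg v hvK)).2.1
      · rw [hJp g hg v hvK, h.depth v hv]
        exact Nat.lt_succ_self _
  obtain ⟨S, hS, hpair, hcard⟩ := exists_spanningTrees_of_fibers specialDepths
    (fun _ _ φ v => specialDepths_iso φ v) J id hpar (((#K + 1) * (s * (s + 1))) ^ #K) fun D => by
      by_cases hD : #D ≤ s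
      · let C : V → Finset V := fun v =>
          (insert r K ×ˢ (D ×ˢ insert 0 (D.image (· + 1)))).image
            fun a => p^[δ v - (a.2.1 - a.2.2 + δ a.1)] v
        have hC : ∀ v, #(C v) ≤ (#K + 1) * (s * (s + 1)) := by
          intro v
          refine card_image_le.trans ?_
          rw [card_product, card_product]
          refine Nat.mul_le_mul (card_insert_le _ _) (Nat.mul_le_mul hD ?_)
          refine (card_insert_le _ _).trans ?_
          exact Nat.succ_le_succ (card_image_le.trans hD)
        calc _ ≤ #(Fintype.piFinset fun v => if v ∈ K then C v else {p v}) := by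
              refine card_le_card fun g hg => ?_
              rw [mem_filter] at hg
              obtain ⟨hgJ, hgD⟩ := hg
              obtain ⟨δ', h'⟩ := hpar g hgJ
              have hspec : ∀ w ∈ K, δ' (g w) ∈ D := by
                intro w hw
                obtain ⟨hadj, hlt, hnot⟩ := hU w hw _ (hJK g hgJ w hw)
                have hch := h.iterate_mem_children hadj hlt
                set y := p^[δ w - δ (g w) - 1] w
                have hych := mem_children.1 hch
                have hyK : y ∉ K := fun hyK => hnot (mem_image.2 ⟨y, hyK, hych.2⟩)
                rw [← hgD]
                refine h'.mem_specialDepths_of_two (y := w) (y' := y) ?_ ?_ ?_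
                · rintro heq
                  exact hyK (heq ▸ hw)
                · exact mem_children.2 ⟨fun heq => hr (heq ▸ hw), rfl⟩
                · exact mem_children.2 ⟨hych.1, (hJp g hgJ y hyK).trans hych.2⟩
              rw [Fintype.mem_piFinset]
              intro v
              split_ifs with hv
              · obtain ⟨t, ht, hle, heq⟩ := h.exists_depth_shift h' K (hJp g hgJ) (g v)
                refine mem_image.2 ⟨(t, δ' (g v), δ' t), ?_, ?_⟩
                · simp only [mem_product, mem_insert, mem_image]
                  refine ⟨ht, hspec v hv, ?_⟩
                  rcases ht with rfl | ht
                  · exact Or.inl h'.depth_root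
                  · exact Or.inr ⟨_, hspec t ht, (h'.depth t fun heq => hr (heq ▸ ht)).symm⟩
                · obtain ⟨hadj, hlt, -⟩ := hU v hv _ (hJK g hgJ v hv)
                  dsimp only
                  rw [show δ' (g v) - δ' t + δ t = δ (g v) by omega]
                  exact (h.normal _ _ hadj hlt.le).2
              · rw [hJp g hgJ v hv, mem_singleton]
          _ = ∏ w ∈ K, #(C w) := hprod C
          _ ≤ _ := prod_le_pow_card _ _ _ fun w _ => hC w
      · rw [filter_eq_empty_iff.2, card_empty]
        · exact Nat.zero_le _
        · rintro g hg rfl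
          obtain ⟨δ', h'⟩ := hpar g hg
          exact hD ((h'.card_specialDepths_le K (hJp g hg)).trans hs)
  refine ⟨S, hS, hpair, le_trans ?_ hcard⟩
  rw [hJ, hprod]
  exact pow_card_le_prod _ _ _ hq

end IsNormalParentMap

end Families

/-- A graph of a function decreasing on a set of numbers is bipartite there, so that half of the set
is independent. -/
theorem exists_independent_half (A : Finset ℕ) (g : ℕ → ℕ) (hg : ∀ a ∈ A, g a < a) :
    ∃ A' ⊆ A, #A ≤ 2 * #A' ∧ ∀ a ∈ A', ∀ a' ∈ A', g a ≠ a' := by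
  have hcol : ∃ col : ℕ → Bool, ∀ a ∈ A, col a ≠ col (g a) := by
    induction A using Finset.induction_on_max with
    | empty => exact ⟨fun _ => true, by simp⟩
    | insert a s has ih =>
      obtain ⟨col, hcol⟩ := ih fun x hx => hg x (mem_insert_of_mem hx)
      refine ⟨update col a (!col (g a)), fun x hx => ?_⟩
      have hgx := hg x hx
      rcases mem_insert.1 hx with rfl | hx
      · rw [update_self, update_of_ne hgx.ne]
        simp
      · have hxa := has x hx
        rw [update_of_ne hxa.ne, update_of_ne (hgx.trans hxa).ne]
        exact hcol x hx
  obtain ⟨col, hcol⟩ := hcol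
  have hind : ∀ x, ∀ a ∈ {a ∈ A | col a = x}, ∀ a' ∈ {a ∈ A | col a = x}, g a ≠ a' := by
    rintro x a ha _ ha' rfl
    rw [mem_filter] at ha ha'
    exact hcol a ha.1 (ha.2.trans ha'.2.symm)
  have hcard := card_filter_add_card_filter_not (s := A) (fun a => col a = true)
  simp only [Bool.not_eq_true] at hcard
  by_cases hle : #{a ∈ A | col a = false} ≤ #{a ∈ A | col a = true}
  · exact ⟨_, filter_subset _ _, by omega, hind true⟩
  · exact ⟨_, filter_subset _ _, by omega, hind false⟩

theorem IsParentMap.depth_eq_add_of_chain {G : SimpleGraph V} {r : V} {f : V → V} {δ : V → ℕ}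
    (h : IsParentMap G r f δ) {c : ℕ → V} {m j : ℕ} (hmj : m ≤ j)
    (hc : ∀ i, m ≤ i → i < j → c (i + 1) ≠ r ∧ f (c (i + 1)) = c i) :
    δ (c j) = δ (c m) + (j - m) := by
  induction j, hmj using Nat.le_induction with
  | base => omega
  | succ j hmj ih =>
    obtain ⟨hr, hf⟩ := hc j hmj (Nat.lt_succ_self j)
    rw [h.depth _ hr, hf, ih fun i hi hij => hc i hi (hij.trans (Nat.lt_succ_self j))]
    omega

section Chain

variable [Fintype V] {G : SimpleGraph V} {r : V} {p : V → V} {δ : V → ℕ}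

open scoped Classical in
/-- Reattaching vertices of a chain, each to another vertex of the chain, when the positions of the
modified vertices are increasing and do not interfere. -/
theorem IsNormalParentMap.exists_specialDepths_of_chain (h : IsNormalParentMap G r p δ)
    {c : ℕ → V} {m : ℕ} (hcδ : ∀ j ≤ m, δ (c j) = j) (hcp : ∀ j < m, p (c (j + 1)) = c j)
    {A : Finset ℕ} {b : ℕ → ℕ} (hA : ∀ j ∈ A, j ≤ m ∧ b j + 1 < j ∧ G.Adj (c (b j)) (c j) ∧
      children r p (c (j - 1)) = {c j}) (hsep : ∀ j ∈ A, ∀ j' ∈ A, b j + 1 ≠ j')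
    {k : ℕ} {d : Fin k → ℕ} (hd : StrictMono d) (hdA : ∀ i, d i ∈ A) :
    ∃ (f : V → V) (δ' : V → ℕ) (α β : Fin k → ℕ), IsParentMap G r f δ' ∧
      #(specialDepths (parentGraph f) r) ≤ 2 * (#{x | children r p x = ∅} + k) ∧
      (∀ i, α i ∈ specialDepths (parentGraph f) r ∧ β i ∈ specialDepths (parentGraph f) r) ∧
      (∀ h0 : 0 < k, d ⟨0, h0⟩ = α ⟨0, h0⟩ + 1) ∧
      ∀ n (hn : n + 1 < k), α ⟨n + 1, hn⟩ + d ⟨n, by omega⟩ =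
        β ⟨n, by omega⟩ + d ⟨n + 1, hn⟩ := by
  set K : Finset V := univ.image fun i => c (d i) with hK
  have memK : ∀ j ≤ m, c j ∈ K → ∃ i, d i = j := by
    intro j hj hcK
    obtain ⟨i, -, hi⟩ := mem_image.1 hcK
    refine ⟨i, ?_⟩
    rw [← hcδ j hj, ← hi, hcδ _ (hA _ (hdA i)).1]
  have hne : ∀ j ≤ m, 0 < j → c j ≠ r := fun j hj h0 => h.ne_root (by rw [hcδ j hj]; exact h0)
  let f : V → V := fun v => if v ∈ K then c (b (δ v)) else p v
  have hfp : ∀ v ∉ K, f v = p v := fun v hv => if_neg hv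
  have hfd : ∀ i, f (c (d i)) = c (b (d i)) := by
    intro i
    simp only [f]
    rw [if_pos (mem_image_of_mem _ (mem_univ i)), hcδ _ (hA _ (hdA i)).1]
  have hrK : r ∉ K := by
    intro hr
    obtain ⟨i, -, hi⟩ := mem_image.1 hr
    have := hA _ (hdA i)
    exact hne (d i) this.1 (by omega) hi
  obtain ⟨δ', h'⟩ : ∃ δ', IsParentMap G r f δ' := by
    refine IsParentMap.exists_of_lt (ρ := δ) ((hfp r hrK).trans h.map_root) ?_ ?_
    · intro v hv
      by_cases hvK : v ∈ K
      · obtain ⟨i, -, rfl⟩ := mem_image.1 hvK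
        rw [hfd]
        exact (hA _ (hdA i)).2.2.1.symm
      · rw [hfp v hvK]
        exact h.adj v hv
    · intro v hv
      by_cases hvK : v ∈ K
      · obtain ⟨i, -, rfl⟩ := mem_image.1 hvK
        obtain ⟨h1, h2, -⟩ := hA _ (hdA i)
        rw [hfd, hcδ _ h1, hcδ _ (by omega)]
        omega
      · rw [hfp v hvK, h.depth v hv]
        exact Nat.lt_succ_self _
  have hstep : ∀ j < m, (∀ i, d i ≠ j + 1) → c (j + 1) ≠ r ∧ f (c (j + 1)) = c j := by
    intro j hj hdj
    refine ⟨hne _ hj (Nat.succ_pos j), ?_⟩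
    rw [hfp _ fun hmem => ?_, hcp j hj]
    obtain ⟨i, hi⟩ := memK _ hj hmem
    exact hdj i hi
  refine ⟨f, δ', fun i => δ' (c (d i - 1)), fun i => δ' (c (b (d i))), h', ?_, fun i => ⟨?_, ?_⟩,
    fun h0 => ?_, fun n hn => ?_⟩
  · refine (h'.card_specialDepths_le K hfp).trans ?_
    have : #K ≤ k := card_image_le.trans (card_fin k).le
    omega
  · refine h'.mem_specialDepths_of_empty (eq_empty_of_forall_notMem fun y hy => ?_)
    obtain ⟨hyr, hy⟩ := mem_children.1 hy
    obtain ⟨h1, h2, -, h3⟩ := hA _ (hdA i)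
    by_cases hyK : y ∈ K
    · obtain ⟨i', -, rfl⟩ := mem_image.1 hyK
      obtain ⟨h1', h2', -⟩ := hA _ (hdA i')
      rw [hfd] at hy
      have := congrArg δ hy
      rw [hcδ _ (by omega), hcδ _ (by omega)] at this
      exact hsep _ (hdA i') _ (hdA i) (by omega)
    · rw [hfp y hyK] at hy
      have hmem := mem_children.2 ⟨hyr, hy⟩
      rw [h3, mem_singleton] at hmem
      exact hyK (hmem ▸ mem_image_of_mem _ (mem_univ i))
  · obtain ⟨h1, h2, -⟩ := hA _ (hdA i)
    obtain ⟨hr, hf⟩ := hstep (b (d i)) (by omega) fun i' hi' =>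
      hsep _ (hdA i) _ (hdA i') hi'.symm
    refine h'.mem_specialDepths_of_two (y := c (d i)) (y' := c (b (d i) + 1)) ?_ ?_ ?_
    · intro heq
      have := congrArg δ heq
      rw [hcδ _ h1, hcδ _ (by omega)] at this
      omega
    · exact mem_children.2 ⟨hne _ h1 (by omega), hfd i⟩
    · exact mem_children.2 ⟨hr, hf⟩
  · obtain ⟨h1, h2, -⟩ := hA _ (hdA ⟨0, h0⟩)
    dsimp only
    rw [h'.depth_eq_add_of_chain (c := c) (Nat.zero_le (d ⟨0, h0⟩ - 1)),
      h.eq_root_of_depth_eq_zero (hcδ 0 (Nat.zero_le m)), h'.depth_root]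
    · omega
    · refine fun i _ hi => hstep i (by omega) fun i' heq => ?_
      have := hd.monotone (Fin.le_def.2 (Nat.zero_le _) : (⟨0, h0⟩ : Fin k) ≤ i')
      omega
  · obtain ⟨h1, h2, -⟩ := hA _ (hdA ⟨n, by omega⟩)
    obtain ⟨h1', h2', -⟩ := hA _ (hdA ⟨n + 1, hn⟩)
    have hlt : d ⟨n, by omega⟩ < d ⟨n + 1, hn⟩ := hd (Fin.lt_def.2 (Nat.lt_succ_self n))
    dsimp only
    rw [h'.depth_eq_add_of_chain (c := c) (Nat.le_sub_one_of_lt hlt),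
      h'.depth _ (hne _ h1 (by omega)), hfd]
    · omega
    · refine fun i hi hi' => hstep i (by omega) fun i' heq => ?_
      rcases Nat.lt_or_ge n i'.1 with hni | hni
      · have := hd.monotone (Fin.le_def.2 hni : (⟨n + 1, hn⟩ : Fin k) ≤ i')
        omega
      · have := hd.monotone (Fin.le_def.2 hni : i' ≤ (⟨n, by omega⟩ : Fin k))
        omega

open scoped Classical in
/-- A long chain with many edges of `G` going back along it. -/
theorem IsNormalParentMap.exists_spanningTrees_of_chain (h : IsNormalParentMap G r p δ)
    {c : ℕ → V} {m : ℕ} (hcδ : ∀ j ≤ m, δ (c j) = j) (hcp : ∀ j < m, p (c (j + 1)) = c j)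
    {A : Finset ℕ} {b : ℕ → ℕ} (hA : ∀ j ∈ A, j ≤ m ∧ b j + 1 < j ∧ G.Adj (c (b j)) (c j) ∧
      children r p (c (j - 1)) = {c j}) (hsep : ∀ j ∈ A, ∀ j' ∈ A, b j + 1 ≠ j')
    {k q s : ℕ} (hkq : k * q ≤ #A) (hs : 2 * (#{x | children r p x = ∅} + k) ≤ s) :
    ∃ S : Finset (SimpleGraph V), (∀ T ∈ S, T ≤ G ∧ T.IsTree) ∧
      (∀ T ∈ S, ∀ T' ∈ S, T ≠ T' → IsEmpty (T ≃g T')) ∧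
      q ^ k ≤ (s * s) ^ k * (Fintype.card V * #S) := by
  have henum : ∃ e : ℕ → ℕ, (∀ i < #A, e i ∈ A) ∧ ∀ i j, i < j → j < #A → e i < e j := by
    refine ⟨fun i => if hi : i < #A then A.orderEmbOfFin rfl ⟨i, hi⟩ else 0, fun i hi => ?_,
      fun i j hij hj => ?_⟩
    · dsimp only
      rw [dif_pos hi]
      exact orderEmbOfFin_mem _ _ _
    · dsimp only
      rw [dif_pos hj, dif_pos (hij.trans hj), OrderEmbedding.lt_iff_lt]
      exact Fin.lt_def.2 hij
  obtain ⟨e, heA, he⟩ := henum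
  have hlt : ∀ (i : Fin k) (x : ℕ), x < q → i * q + x < #A := by
    intro i x hx
    have := Nat.mul_le_mul_right q (Nat.succ_le_of_lt i.2)
    rw [Nat.succ_mul] at this
    omega
  let d : (Fin k → ℕ) → Fin k → ℕ := fun g i => e (i * q + g i)
  set J := Fintype.piFinset fun _ : Fin k => range q with hJ
  have hJq : ∀ g ∈ J, ∀ i, g i < q := fun g hg i => mem_range.1 (Fintype.mem_piFinset.1 hg i)
  have hdA : ∀ g ∈ J, ∀ i, d g i ∈ A := fun g hg i => heA _ (hlt i _ (hJq g hg i))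
  have hd : ∀ g ∈ J, StrictMono (d g) := by
    intro g hg i i' hii
    refine he _ _ ?_ (hlt i' _ (hJq g hg i'))
    have := Nat.mul_le_mul_right q (Nat.succ_le_of_lt (Fin.lt_def.1 hii))
    rw [Nat.succ_mul] at this
    have := hJq g hg i
    omega
  have hinj : ∀ g ∈ J, ∀ g' ∈ J, ∀ i, d g i = d g' i → g i = g' i := by
    intro g hg g' hg' i heq
    by_contra hne
    rcases Nat.lt_or_gt_of_ne hne with hgg | hgg
    · exact (he _ _ (Nat.add_lt_add_left hgg (i * q)) (hlt i _ (hJq g' hg' i))).ne heq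
    · exact (he _ _ (Nat.add_lt_add_left hgg (i * q)) (hlt i _ (hJq g hg i))).ne' heq
  have : Nonempty V := ⟨r⟩
  have hex := fun g hg => h.exists_specialDepths_of_chain hcδ hcp hA hsep (hd g hg) (hdA g hg)
  choose! f δ' α β hpar hcard hspec hzero hsucc using hex
  obtain ⟨S, hS, hpair, hle⟩ := exists_spanningTrees_of_fibers specialDepths
    (fun _ _ φ v => specialDepths_iso φ v) J f (fun g hg => ⟨_, hpar g hg⟩) ((s * s) ^ k)
    fun D => by
      by_cases hD : #D ≤ s
      · calc _ ≤ #(Fintype.piFinset fun _ : Fin k => D ×ˢ D) := by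
              refine card_le_card_of_injOn (fun g i => (α g i, β g i)) ?_ ?_
              · intro g hg
                obtain ⟨hgJ, rfl⟩ := mem_filter.1 hg
                exact Fintype.mem_piFinset.2 fun i => mem_product.2 (hspec g hgJ i)
              · intro g hg g' hg' heq
                have hgJ := (mem_filter.1 hg).1
                have hgJ' := (mem_filter.1 hg').1
                have hα : ∀ i, α g i = α g' i := fun i => congrArg Prod.fst (congrFun heq i)
                have hβ : ∀ i, β g i = β g' i := fun i => congrArg Prod.snd (congrFun heq i)
                have hdd : ∀ n (hn : n < k), d g ⟨n, hn⟩ = d g' ⟨n, hn⟩ := by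
                  intro n
                  induction n with
                  | zero => exact fun h0 => by rw [hzero g hgJ, hzero g' hgJ', hα]
                  | succ n ih =>
                    intro hn
                    have h1 := hsucc g hgJ n hn
                    have h2 := hsucc g' hgJ' n hn
                    rw [ih, hα, hβ] at h1
                    omega
                funext i
                exact hinj g hgJ g' hgJ' i (hdd i.1 i.2)
          _ = (#D * #D) ^ k := by simp [Fintype.card_piFinset, card_product]
          _ ≤ (s * s) ^ k := Nat.pow_le_pow_left (Nat.mul_le_mul hD hD) k
      · rw [filter_eq_empty_iff.2, card_empty]
        · exact Nat.zero_le _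
        · rintro g hg rfl
          exact hD ((hcard g hg).trans hs)
  refine ⟨S, hS, hpair, le_trans (le_of_eq ?_) hle⟩
  simp [hJ, Fintype.card_piFinset]

end Chain

section Counting

variable [Fintype V] {G : SimpleGraph V} {r : V} {p : V → V} {δ : V → ℕ}

open scoped Classical in
/-- The neighbours of `w` of smaller depth, other than its parent. -/
noncomputable def backNeighbors (G : SimpleGraph V) (p : V → V) (δ : V → ℕ) (w : V) : Finset V :=
  {u | G.Adj u w ∧ δ u < δ w ∧ u ≠ p w}

theorem mem_backNeighbors {u w : V} :
    u ∈ backNeighbors G p δ w ↔ G.Adj u w ∧ δ u < δ w ∧ u ≠ p w := by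
  simp [backNeighbors]

namespace IsNormalParentMap

open scoped Classical in
theorem sum_card_adj_le (h : IsNormalParentMap G r p δ) :
    ∑ v, #{u | G.Adj u v} ≤ 2 * (Fintype.card V + ∑ w, #(backNeighbors G p δ w)) := by
  have hup : ∑ v, #{u | G.Adj u v ∧ δ u < δ v} ≤
      Fintype.card V + ∑ w, #(backNeighbors G p δ w) := by
    rw [← card_univ, card_eq_sum_ones, ← sum_add_distrib]
    refine sum_le_sum fun v _ => ?_
    refine le_trans (card_le_card (t := insert (p v) (backNeighbors G p δ v)) fun u hu => ?_)
      ((card_insert_le _ _).trans (Nat.add_comm _ _).le)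
    rw [mem_filter_univ] at hu
    rw [mem_insert, mem_backNeighbors]
    tauto
  have hdown : ∑ v, #{u | G.Adj u v ∧ δ v < δ u} = ∑ v, #{u | G.Adj u v ∧ δ u < δ v} := by
    simp only [card_filter]
    rw [sum_comm]
    simp only [G.adj_comm]
  have hsplit : ∑ v, #{u | G.Adj u v} ≤
      ∑ v, #{u | G.Adj u v ∧ δ u < δ v} + ∑ v, #{u | G.Adj u v ∧ δ v < δ u} := by
    rw [← sum_add_distrib]
    refine sum_le_sum fun v _ => (card_le_card fun u hu => ?_).trans (card_union_le _ _)
    rw [mem_filter_univ] at hu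
    rw [mem_union, mem_filter_univ, mem_filter_univ]
    rcases le_or_gt (δ u) (δ v) with hle | hlt
    · exact Or.inl ⟨hu, (h.normal u v hu hle).1⟩
    · exact Or.inr ⟨hu, hlt⟩
  omega

theorem exists_childless_descendant (h : IsNormalParentMap G r p δ) (v : V) :
    ∃ z, children r p z = ∅ ∧ δ v ≤ δ z ∧ p^[δ z - δ v] z = v := by
  classical
  obtain ⟨z, hz, hmax⟩ := exists_max_image {z | δ v ≤ δ z ∧ p^[δ z - δ v] z = v} δ
    ⟨v, by simp⟩
  simp only [mem_filter_univ] at hz hmax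
  refine ⟨z, eq_empty_of_forall_notMem fun y hy => ?_, hz⟩
  obtain ⟨hyr, hy⟩ := mem_children.1 hy
  have hd := h.depth y hyr
  rw [hy] at hd
  have := hmax y ⟨by omega, ?_⟩
  · omega
  · rw [show δ y - δ v = δ z - δ v + 1 by omega, iterate_succ_apply, hy, hz.2]

open scoped Classical in
/-- Many vertices with a back neighbour in a tree with few leaves. -/
theorem exists_spanningTrees_of_backNeighbors (h : IsNormalParentMap G r p δ) (W : Finset V)
    (hW : ∀ w ∈ W, (backNeighbors G p δ w).Nonempty) {k q s : ℕ}
    (hs : 2 * (#{x | children r p x = ∅} + k) ≤ s)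
    (hcard : #{x | children r p x = ∅} * (2 + 2 * (k * q)) ≤ #W) :
    ∃ S : Finset (SimpleGraph V), (∀ T ∈ S, T ≤ G ∧ T.IsTree) ∧
      (∀ T ∈ S, ∀ T' ∈ S, T ≠ T' → IsEmpty (T ≃g T')) ∧
      q ^ k ≤ (s * s) ^ k * (Fintype.card V * #S) := by
  have : Nonempty V := ⟨r⟩
  choose! u hu using hW
  simp only [mem_backNeighbors] at hu
  set Z : Finset V := {x | children r p x = ∅} with hZ
  have hWr : ∀ w ∈ W, w ≠ r := fun w hw => h.ne_root (Nat.zero_lt_of_lt (hu w hw).2.1)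
  have hunary : #Z * (2 * (k * q)) ≤ #{w ∈ W | #(children r p (p w)) = 1} := by
    have hbr : _ ≤ 2 * #Z := sum_card_children_branching r p
    have hrest : #{w ∈ W | ¬#(children r p (p w)) = 1} ≤
        ∑ x with 2 ≤ #(children r p x), #(children r p x) := by
      refine (card_le_card fun w hw => ?_).trans card_biUnion_le
      rw [mem_filter] at hw
      have hmem : w ∈ children r p (p w) := mem_children.2 ⟨hWr w hw.1, rfl⟩
      refine mem_biUnion.2 ⟨p w, ?_, hmem⟩
      rw [mem_filter_univ]
      have := card_pos.2 ⟨w, hmem⟩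
      omega
    have := card_filter_add_card_filter_not (s := W) (fun w => #(children r p (p w)) = 1)
    rw [Nat.mul_add] at hcard
    omega
  choose leaf hleaf using h.exists_childless_descendant
  obtain ⟨z, -, hz⟩ := exists_le_card_fiber_of_mul_le_card_of_maps_to
    (s := {w ∈ W | #(children r p (p w)) = 1}) (t := Z) (f := leaf)
    (fun w _ => by rw [hZ, mem_filter_univ]; exact (hleaf w).1)
    ⟨leaf r, by rw [hZ, mem_filter_univ]; exact (hleaf r).1⟩ hunary
  set Y : Finset V := {w ∈ {w ∈ W | #(children r p (p w)) = 1} | leaf w = z} with hY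
  set c : ℕ → V := fun j => p^[δ z - j] z with hc
  have hcδ : ∀ j ≤ δ z, δ (c j) = j := by
    intro j hj
    rw [hc, h.depth_iterate]
    omega
  have hcp : ∀ j < δ z, p (c (j + 1)) = c j := by
    intro j hj
    simp only [hc]
    rw [← iterate_succ_apply' p, show (δ z - (j + 1)).succ = δ z - j by omega]
  have hmemY : ∀ w ∈ Y, w ∈ W ∧ #(children r p (p w)) = 1 ∧ δ w ≤ δ z ∧ c (δ w) = w := by
    intro w hw
    rw [hY, mem_filter, mem_filter] at hw
    obtain ⟨⟨hwW, hw1⟩, rfl⟩ := hw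
    exact ⟨hwW, hw1, (hleaf w).2⟩
  obtain ⟨A, hA, hhalf, hsep⟩ := exists_independent_half (Y.image δ) (fun j => δ (u (c j)) + 1)
    (by
      intro j hj
      obtain ⟨w, hw, rfl⟩ := mem_image.1 hj
      obtain ⟨hwW, -, -, hcw⟩ := hmemY w hw
      obtain ⟨hadj, hlt, hne⟩ := hu w hwW
      rw [hcw]
      refine lt_of_le_of_ne hlt fun heq => hne ?_
      have := (h.normal _ _ hadj hlt.le).2
      rw [show δ w - δ (u w) = 1 by omega] at this
      exact this.symm)
  have hcardA : k * q ≤ #A := by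
    rw [card_image_of_injOn] at hhalf
    · omega
    · intro w hw w' hw' heq
      rw [← (hmemY w hw).2.2.2, ← (hmemY w' hw').2.2.2, heq]
  refine h.exists_spanningTrees_of_chain hcδ hcp (A := A) (b := fun j => δ (u (c j)))
    (fun j hj => ?_) hsep hcardA hs
  obtain ⟨w, hw, rfl⟩ := mem_image.1 (hA hj)
  obtain ⟨hwW, hw1, hle, hcw⟩ := hmemY w hw
  obtain ⟨hadj, hlt, hne⟩ := hu w hwW
  have hanc := (h.normal _ _ hadj hlt.le).2
  have hcu : c (δ (u w)) = u w := by
    have : δ z - δ (u w) = δ w - δ (u w) + (δ z - δ w) := by omega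
    simp only [hc]
    rw [this, iterate_add_apply]
    exact (congrArg _ hcw).trans hanc
  rw [hcw, hcu]
  refine ⟨hle, lt_of_le_of_ne hlt fun heq => hne ?_, hadj, ?_⟩
  · rw [show δ w - δ (u w) = 1 by omega] at hanc
    exact hanc.symm
  · have hcpw : c (δ w - 1) = p w := by
      rw [← hcp (δ w - 1) (by omega), show δ w - 1 + 1 = δ w by omega, hcw]
    rw [hcpw]
    obtain ⟨x, hx⟩ := card_eq_one.1 hw1
    have hmem : w ∈ children r p (p w) := mem_children.2 ⟨hWr w hwW, rfl⟩
    rw [hx, mem_singleton] at hmem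
    rw [hx, hmem]

open scoped Classical in
/-- A normal tree with few leaves in a graph of large minimum degree. -/
theorem exists_spanningTrees_of_few_leaves (h : IsNormalParentMap G r p δ) {k B : ℕ}
    (hdeg : ∀ v, 2 * (k + 2) < #{u | G.Adj u v}) (hB : 2 * k + 4 ≤ B)
    (hn : B ^ 19 ≤ Fintype.card V) (hZ : #{x | children r p x = ∅} ≤ B ^ 2) :
    ∃ S : Finset (SimpleGraph V), (∀ T ∈ S, T ≤ G ∧ T.IsTree) ∧
      (∀ T ∈ S, ∀ T' ∈ S, T ≠ T' → IsEmpty (T ≃g T')) ∧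
      B ^ k ≤ Fintype.card V * #S := by
  have hpow : ∀ i, (2 * k + 4) * B ^ i ≤ B ^ (i + 1) := fun i => by
    rw [pow_succ']
    exact Nat.mul_le_mul_right _ hB
  have hs : 2 * (#{x | children r p x = ∅} + k) ≤ B ^ 3 := by
    have h2 := hpow 2
    have h1 := hpow 1
    nlinarith [Nat.zero_le (k * B ^ 2), Nat.zero_le (k * B)]
  have hcancel : ∀ {q x N : ℕ}, 0 < x → x * B ≤ q → q ^ k ≤ x ^ k * N → B ^ k ≤ N := by
    intro q x N hx hxq hle
    refine Nat.le_of_mul_le_mul_left ?_ (pow_pos hx k)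
    rw [← mul_pow]
    exact (Nat.pow_le_pow_left hxq k).trans hle
  have hBpos : 0 < B := by omega
  set R : Finset V := {w | B ^ 9 ≤ #(backNeighbors G p δ w)} with hR
  by_cases hRk : k ≤ #R
  · obtain ⟨K, hKR, hK⟩ := exists_subset_card_eq hRk
    have hKb : ∀ w ∈ K, B ^ 9 ≤ #(backNeighbors G p δ w) := fun w hw => by
      simpa [hR] using hKR hw
    have hrK : r ∉ K := by
      intro hr
      obtain ⟨u, hu⟩ := card_pos.1 (lt_of_lt_of_le (pow_pos hBpos 9) (hKb r hr))
      have := (mem_backNeighbors.1 hu).2.1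
      rw [h.depth_root] at this
      exact Nat.not_lt_zero _ this
    obtain ⟨S, hS, hpair, hle⟩ := h.exists_spanningTrees_of_large_updegree K hrK
      (fun w => backNeighbors G p δ w \ K.image p) (q := B ^ 8) (s := B ^ 3)
      (fun w hw u hu => by
        rw [mem_sdiff, mem_backNeighbors] at hu
        exact ⟨hu.1.1, hu.1.2.1, hu.2⟩)
      (fun w hw => by
        have h1 := le_card_sdiff (K.image p) (backNeighbors G p δ w)
        have h2 : #(K.image p) ≤ k := card_image_le.trans hK.le
        have h3 := hKb w hw
        have h4 := hpow 8
        have h5 : 1 ≤ B ^ 8 := Nat.one_le_pow _ _ hBpos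
        have h6 : k + B ^ 8 ≤ B ^ 9 := by nlinarith
        omega)
      (by rw [hK]; exact hs)
    rw [hK] at hle
    refine ⟨S, hS, hpair, hcancel (by positivity) ?_ hle⟩
    have h7 := hpow 7
    have h4 : B ^ 4 ≤ B ^ 7 := Nat.pow_le_pow_right hBpos (by norm_num)
    calc (k + 1) * (B ^ 3 * (B ^ 3 + 1)) * B = (k + 1) * (B ^ 7 + B ^ 4) := by ring
      _ ≤ (k + 1) * (B ^ 7 + B ^ 7) := by gcongr
      _ ≤ (2 * k + 4) * B ^ 7 := by nlinarith
      _ ≤ B ^ 8 := h7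
  · set W : Finset V := {w | (backNeighbors G p δ w).Nonempty} with hW
    have hWcard : B ^ 10 ≤ #W := by
      by_contra! hlt
      have hback : ∑ w, #(backNeighbors G p δ w) ≤ k * Fintype.card V + B ^ 19 := by
        calc ∑ w, #(backNeighbors G p δ w)
            ≤ ∑ w, ((if w ∈ R then Fintype.card V else 0) + if w ∈ W then B ^ 9 else 0) := by
              refine sum_le_sum fun w _ => ?_
              by_cases hwR : w ∈ R
              · rw [if_pos hwR]
                exact (card_le_univ _).trans (Nat.le_add_right _ _)
              · by_cases hwW : w ∈ W
                · rw [if_neg hwR, if_pos hwW, zero_add]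
                  rw [hR, mem_filter_univ] at hwR
                  exact (not_le.1 hwR).le
                · rw [hW, mem_filter_univ, not_nonempty_iff_eq_empty] at hwW
                  simp [hwW]
          _ = #R * Fintype.card V + #W * B ^ 9 := by
              simp [sum_add_distrib]
          _ ≤ k * Fintype.card V + B ^ 10 * B ^ 9 := by gcongr; omega
          _ = _ := by ring
      have hsum := h.sum_card_adj_le
      have hlow : Fintype.card V * (2 * (k + 2) + 1) ≤ ∑ v, #{u | G.Adj u v} := by
        rw [← card_univ, ← smul_eq_mul]
        exact card_nsmul_le_sum _ _ _ fun v _ => hdeg v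
      have hpos : 0 < B ^ 19 := pow_pos hBpos 19
      nlinarith
    obtain ⟨S, hS, hpair, hle⟩ := h.exists_spanningTrees_of_backNeighbors W
      (fun w hw => by simpa [hW] using hw) (k := k) (q := B ^ 7) hs (by
        have h9 := hpow 9
        have h2 : B ^ 2 ≤ B ^ 9 := Nat.pow_le_pow_right hBpos (by norm_num)
        calc _ ≤ B ^ 2 * (2 + 2 * (k * B ^ 7)) := Nat.mul_le_mul_right _ hZ
          _ = 2 * B ^ 2 + 2 * k * B ^ 9 := by ring
          _ ≤ #W := by nlinarith)
    exact ⟨S, hS, hpair, hcancel (by positivity) (le_of_eq (by ring)) hle⟩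

end IsNormalParentMap

end Counting

theorem add_one_sq_le_four_mul_two_pow (L : ℕ) : (L + 1) ^ 2 ≤ 4 * 2 ^ L := by
  induction L with
  | zero => norm_num
  | succ L ih =>
    rw [pow_succ 2]
    rcases L with _ | _ | L
    · norm_num
    · norm_num
    · have : (L + 1 + 1 + 1 + 1) ^ 2 ≤ 2 * (L + 1 + 1 + 1) ^ 2 := by
        nlinarith [Nat.zero_le (L * L)]
      omega

open scoped Classical in
theorem exists_spanningTrees [Fintype V] {G : SimpleGraph V} (hG : G.Connected) {k L : ℕ}
    (hdeg : ∀ v, 2 * (k + 2) < #{u | G.Adj u v}) (hL : 4 * (k + 1) ^ 2 ≤ L)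
    (hn : (2 ^ L) ^ 19 ≤ Fintype.card V) :
    ∃ S : Finset (SimpleGraph V), (∀ T ∈ S, T ≤ G ∧ T.IsTree) ∧
      (∀ T ∈ S, ∀ T' ∈ S, T ≠ T' → IsEmpty (T ≃g T')) ∧
      (2 ^ L) ^ k ≤ Fintype.card V * #S := by
  obtain ⟨r⟩ := hG.nonempty
  obtain ⟨p, δ, h⟩ := exists_isNormalParentMap hG r
  by_cases hX : (k + 1) ^ 2 * ((L + 1) * 2 ^ L) ≤ #{x | x ≠ r ∧ children r p x = ∅}
  · rw [← pow_mul]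
    exact h.exists_spanningTrees_of_leaves (fun v => (by omega : k + 1 ≤ 2 * (k + 2)).trans
      (hdeg v).le) hX
  · have hsq := add_one_sq_le_four_mul_two_pow L
    have hlt : L < 2 ^ L := Nat.lt_two_pow_self
    refine h.exists_spanningTrees_of_few_leaves hdeg (by nlinarith) hn ?_
    have hsub : #{x | children r p x = ∅} ≤ #{x | x ≠ r ∧ children r p x = ∅} + 1 := by
      refine (card_le_card fun x hx => ?_).trans (card_insert_le r _)
      rw [mem_filter_univ] at hx
      rw [mem_insert, mem_filter_univ]
      tauto
    calc _ ≤ (k + 1) ^ 2 * ((L + 1) * 2 ^ L) := by omega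
      _ = (k + 1) ^ 2 * (L + 1) * 2 ^ L := by ring
      _ ≤ 2 ^ L * 2 ^ L := by
        gcongr
        nlinarith
      _ = (2 ^ L) ^ 2 := by ring

end SpanningTreeCount

/-- There exist constants `c > 0` and `d₀` such that for every `d ≥ d₀` and every `n`
sufficiently large relative to `d`: if `G` is a connected graph with `n` vertices and
minimum degree at least `d`, then the number of pairwise non-isomorphic spanning trees
of `G` is at least `n^{c·d}`. -/
theorem nonisomorphic_spanning_trees_min_degree :
    ∃ (c : ℝ) (d₀ : ℕ), 0 < c ∧
      ∀ d : ℕ, d₀ ≤ d → ∃ n₀ : ℕ,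
        ∀ (V : Type) [Fintype V] [DecidableEq V] (G : SimpleGraph V) [DecidableRel G.Adj],
          n₀ ≤ Fintype.card V → G.Connected → (∀ v : V, d ≤ G.degree v) →
          ∃ S : Finset (SimpleGraph V),
            (∀ T ∈ S, T ≤ G ∧ T.IsTree) ∧
            (∀ T ∈ S, ∀ T' ∈ S, T ≠ T' → IsEmpty (T ≃g T')) ∧
            (Fintype.card V : ℝ) ^ (c * d) ≤ (S.card : ℝ) := by
  classical
  refine ⟨1 / 1000, 1000, by norm_num, fun d hd =>
    ⟨2 ^ (20 * (4 * (d / 4 + 1) ^ 2)), fun V _ _ G _ hn hG hdeg => ?_⟩⟩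
  obtain ⟨k, hk⟩ : ∃ k, d / 4 = k := ⟨_, rfl⟩
  rw [hk] at hn
  have hn0 : Fintype.card V ≠ 0 := (lt_of_lt_of_le (by positivity) hn).ne'
  set L := Nat.log 2 (Fintype.card V) / 20 with hLdef
  have hlog := Nat.le_log_of_pow_le (by norm_num) hn
  have hL : 4 * (k + 1) ^ 2 ≤ L := by omega
  have hLpos : 1 ≤ L := by nlinarith
  have hlow : (2 ^ L) ^ 19 ≤ Fintype.card V := by
    rw [← pow_mul]
    exact (Nat.pow_le_pow_right (by norm_num) (by omega)).trans (Nat.pow_log_le_self 2 hn0)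
  have hup : Fintype.card V ≤ (2 ^ L) ^ 40 := by
    rw [← pow_mul]
    exact (Nat.lt_pow_succ_log_self (by norm_num) _).le.trans
      (Nat.pow_le_pow_right (by norm_num) (by omega))
  obtain ⟨S, hS, hpair, hle⟩ := SpanningTreeCount.exists_spanningTrees hG (k := k)
    (fun v => by
      refine (by omega : 2 * (k + 2) < d).trans_le ((hdeg v).trans (le_of_eq ?_))
      rw [← G.card_neighborFinset_eq_degree]
      congr 1
      ext u
      simp [G.adj_comm]) hL hlow
  refine ⟨S, hS, hpair, ?_⟩
  have hB1 : (1 : ℝ) ≤ 2 ^ L := one_le_pow₀ (by norm_num)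
  have hSB : (2 ^ L) ^ (k - 40) ≤ #S := by
    refine Nat.le_of_mul_le_mul_left ?_ (by positivity : 0 < (2 ^ L) ^ 40)
    rw [← pow_add, show 40 + (k - 40) = k by omega]
    exact hle.trans (Nat.mul_le_mul_right _ hup)
  calc (Fintype.card V : ℝ) ^ ((1 / 1000 : ℝ) * d)
      ≤ (((2 : ℝ) ^ L) ^ 40) ^ ((1 / 1000 : ℝ) * d) := by
        refine Real.rpow_le_rpow (by positivity) (by exact_mod_cast hup) (by positivity)
    _ = ((2 : ℝ) ^ L) ^ ((d : ℝ) / 25) := by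
        rw [← Real.rpow_natCast _ 40, ← Real.rpow_mul (by positivity)]
        congr 1
        push_cast
        ring
    _ ≤ ((2 : ℝ) ^ L) ^ ((k - 40 : ℕ) : ℝ) := by
        refine Real.rpow_le_rpow_of_exponent_le hB1 ?_
        have : d ≤ 25 * (k - 40) := by omega
        have : (d : ℝ) ≤ 25 * ((k - 40 : ℕ) : ℝ) := by exact_mod_cast this
        linarith
    _ ≤ #S := by
        rw [Real.rpow_natCast]
        exact_mod_cast hSB
end

section
/- There exists an absolute constant C > 0 such that for every d ≥ 2 and every sufficiently large n the following holds: if G is a connected graph with n vertices and minimum degree at least d, and 𝒯 is a uniformly random spanning tree of G, then ℙ(𝒯 has at most n/8 leaves) ≤ e^{-(1/32 - C·(log d)^2/d)·n}. -/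
open Finset Function

/-- A set `R` meeting every cycle of the functional graph of `f` in exactly one point. -/
structure IsCycleTransversal {V : Type*} (f : V → V) (R : Finset V) : Prop where
  exists_iterate_mem : ∀ v, ∃ i, f^[i] v ∈ R
  mem_periodicPts : ∀ r ∈ R, r ∈ periodicPts f
  iterate_eq : ∀ r ∈ R, ∀ i, f^[i] r ∈ R → f^[i] r = r

/-- The graph formed by the edges `v — f v` with `v` outside `R`. -/
def arrowGraph {V : Type*} (f : V → V) (R : Finset V) : SimpleGraph V :=
  SimpleGraph.fromEdgeSet {e | ∃ v ∉ R, e = s(v, f v)}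

theorem SimpleGraph.IsTree.exists_parent {V : Type*} [Nontrivial V] {T : SimpleGraph V}
    (hT : T.IsTree) :
    ∃ p : V → V, (∀ v, T.Adj v (p v)) ∧ ∀ v w, T.Adj v w → p v = w ∨ p w = v := by
  classical
  obtain ⟨r⟩ := hT.connected.nonempty
  choose q hq using fun v => hT.existsUnique_path v r
  obtain ⟨c, hc⟩ := hT.connected.preconnected.exists_adj_of_nontrivial r
  refine ⟨fun v => if v = r then c else (q v).snd, fun v => ?_, fun v w h => ?_⟩
  · by_cases hv : v = r
    · simpa [hv] using hc
    · simpa [hv] using (q v).adj_snd (fun h => hv h.eq)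
  · by_cases hw : w ∈ (q v).support
    · left
      have hv : v ≠ r := by
        rintro rfl
        have := (hq v).2 .nil (by simp)
        rw [← this] at hw
        simp at hw
        exact h.ne hw.symm
      simp only [hv, if_false]
      exact (hT.isAcyclic.eq_snd_of_adj_start (hq v).1 h hw).symm
    · right
      have hw' : w ≠ r := by rintro rfl; exact hw (q v).end_mem_support
      have := (hq w).2 (.cons h.symm (q v)) ((hq v).1.cons hw)
      simp [hw', ← this]

namespace IsCycleTransversal

variable {V : Type*} {f g : V → V} {R : Finset V}

theorem exists_first_iterate_mem (h : IsCycleTransversal f R) (v : V) :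
    ∃ i, f^[i] v ∈ R ∧ ∀ j < i, f^[j] v ∉ R := by
  classical
  exact ⟨Nat.find (h.exists_iterate_mem v), Nat.find_spec (h.exists_iterate_mem v), fun j hj => Nat.find_min _ hj⟩

theorem not_invariant (h : IsCycleTransversal f R) {P : V → Prop} (hR : ∀ v, P v → v ∉ R)
    (hP : ∀ v, P v → P (f v)) (v : V) : ¬ P v := by
  intro hv
  obtain ⟨i, hi⟩ := h.exists_iterate_mem v
  have : ∀ i, P (f^[i] v) := by
    intro i
    induction i with
    | zero => exact hv
    | succ n ih => rw [iterate_succ_apply']; exact hP _ ih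
  exact hR _ (this i) hi

theorem apply_ne (h : IsCycleTransversal f R) {v : V} (hv : v ∉ R) : f v ≠ v := fun hf =>
  h.not_invariant (P := (· = v)) (by rintro _ rfl; exact hv) (by rintro _ rfl; exact hf) v rfl

theorem apply_apply_ne (h : IsCycleTransversal f R) {v : V} (hv : v ∉ R) (hv' : f v ∉ R) :
    f (f v) ≠ v := fun hf =>
  h.not_invariant (P := fun x => x = v ∨ x = f v)
    (by rintro _ (rfl | rfl) <;> assumption)
    (by rintro _ (rfl | rfl) <;> simp [hf]) v (.inl rfl)

theorem arrowGraph_adj (h : IsCycleTransversal f R) {x y : V} :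
    (arrowGraph f R).Adj x y ↔ (x ∉ R ∧ f x = y) ∨ (y ∉ R ∧ f y = x) := by
  simp only [arrowGraph, SimpleGraph.fromEdgeSet_adj, Set.mem_ofPred_eq, Sym2.eq_iff]
  constructor
  · rintro ⟨⟨v, hv, ⟨rfl, rfl⟩ | ⟨rfl, rfl⟩⟩, -⟩ <;> simp [hv]
  · rintro (⟨hx, rfl⟩ | ⟨hy, rfl⟩)
    · exact ⟨⟨x, hx, by simp⟩, (h.apply_ne hx).symm⟩
    · exact ⟨⟨y, hy, by simp⟩, h.apply_ne hy⟩

theorem eq_of_arrowGraph_eq (hf : IsCycleTransversal f R) (hg : IsCycleTransversal g R)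
    (h : arrowGraph f R = arrowGraph g R) {v : V} (hv : v ∉ R) : f v = g v := by
  by_contra hne
  refine hf.not_invariant (P := fun x => x ∉ R ∧ f x ≠ g x) (fun _ h => h.1) ?_ v ⟨hv, hne⟩
  rintro x ⟨hx, hxne⟩
  have hadj : (arrowGraph g R).Adj x (f x) := h ▸ hf.arrowGraph_adj.2 (.inl ⟨hx, rfl⟩)
  rcases hg.arrowGraph_adj.1 hadj with ⟨-, h'⟩ | ⟨h1, h2⟩
  · exact absurd h'.symm hxne
  · exact ⟨h1, fun h3 => hf.apply_apply_ne hx h1 (h3.trans h2)⟩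

theorem eq_of_arrowGraph_eq_of_image_eq [DecidableEq V] (hf : IsCycleTransversal f R)
    (hg : IsCycleTransversal g R) (h : arrowGraph f R = arrowGraph g R)
    (himage : R.image f = R.image g) : f = g := by
  funext r
  by_cases hr : r ∈ R
  swap
  · exact hf.eq_of_arrowGraph_eq hg h hr
  obtain ⟨r', hr', hs⟩ := mem_image.1 (himage ▸ mem_image_of_mem f hr)
  obtain ⟨i, hi, hlt⟩ := hf.exists_first_iterate_mem (f r)
  have hiter : ∀ j ≤ i, g^[j] (f r) = f^[j] (f r) := by
    intro j hj
    induction j with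
    | zero => rfl
    | succ j ih =>
      rw [iterate_succ_apply', iterate_succ_apply', ih (by omega),
        hf.eq_of_arrowGraph_eq hg h (hlt j (by omega))]
  have h1 : f^[i] (f r) = r := by
    rw [← iterate_succ_apply] at hi ⊢
    exact hf.iterate_eq r hr _ hi
  have h2 : g^[i + 1] r' = r := by rw [iterate_succ_apply, hs, hiter i le_rfl, h1]
  have h3 : r = r' := h2 ▸ hg.iterate_eq r' hr' _ (by rw [h2]; exact hr)
  rw [← hs, h3]

theorem isAcyclic_arrowGraph (h : IsCycleTransversal f R) : (arrowGraph f R).IsAcyclic := by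
  have key : ∀ v ∉ R, ¬ ((arrowGraph f R).deleteEdges {s(v, f v)}).Reachable v (f v) := by
    intro v hv hreach
    let W : V → Prop := fun w => ∃ i, f^[i] w = v ∧ ∀ j < i, f^[j] w ∉ R
    have hstep : ∀ x ∉ R, x ≠ v → (W x ↔ W (f x)) := by
      intro x hx hxv
      constructor
      · rintro ⟨i, hi, hj⟩
        cases i with
        | zero => exact absurd hi hxv
        | succ i => exact ⟨i, hi, fun j hji => hj (j + 1) (by omega)⟩
      · rintro ⟨i, hi, hj⟩
        refine ⟨i + 1, hi, fun j hji => ?_⟩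
        cases j with
        | zero => exact hx
        | succ j => exact hj j (by omega)
    have hadj : ∀ x y, ((arrowGraph f R).deleteEdges {s(v, f v)}).Adj x y → (W x ↔ W y) := by
      intro x y hxy
      rw [SimpleGraph.deleteEdges_adj] at hxy
      obtain ⟨hxy, hne⟩ := hxy
      rcases h.arrowGraph_adj.1 hxy with ⟨hx, rfl⟩ | ⟨hy, rfl⟩
      · exact hstep x hx (by rintro rfl; simp at hne)
      · exact (hstep y hy (by rintro rfl; simp [Sym2.eq_swap] at hne)).symm
    have hW : ∀ x y, ((arrowGraph f R).deleteEdges {s(v, f v)}).Reachable x y → (W x ↔ W y) := by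
      rintro x y ⟨p⟩
      induction p with
      | nil => rfl
      | cons hxy _ ih => exact (hadj _ _ hxy).trans ih
    obtain ⟨i, hi, hj⟩ := (hW _ _ hreach).1 ⟨0, rfl, by simp⟩
    have hper : IsPeriodicPt f (i + 1) v := hi
    obtain ⟨m, hm⟩ := h.exists_iterate_mem v
    rw [← hper.iterate_mod_apply] at hm
    have hlt := Nat.mod_lt m (show 0 < i + 1 by omega)
    rcases Nat.eq_zero_or_pos (m % (i + 1)) with h0 | h0
    · rw [h0] at hm; exact hv hm
    · obtain ⟨j, hj'⟩ := Nat.exists_eq_add_of_lt h0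
      rw [zero_add] at hj'
      rw [hj'] at hm
      exact hj j (by omega) hm
  rw [SimpleGraph.isAcyclic_iff_forall_adj_isBridge]
  intro x y hxy
  rcases h.arrowGraph_adj.1 hxy with ⟨hx, rfl⟩ | ⟨hy, rfl⟩
  · exact SimpleGraph.isBridge_iff.2 (key x hx)
  · rw [Sym2.eq_swap]; exact SimpleGraph.isBridge_iff.2 (key y hy)

end IsCycleTransversal

theorem exists_iterate_eq_of_mem_periodicPts {V : Type*} {f : V → V} {r : V}
    (h : r ∈ periodicPts f) (i : ℕ) : ∃ j, f^[j] (f^[i] r) = r := by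
  obtain ⟨m, hm, hr⟩ := h
  refine ⟨i * m - i, ?_⟩
  rw [← iterate_add_apply, Nat.sub_add_cancel (Nat.le_mul_of_pos_right i hm)]
  exact hr.const_mul i

theorem exists_isCycleTransversal {V : Type*} [Fintype V] (f : V → V) :
    ∃ R, IsCycleTransversal f R := by
  classical
  let ρ := Fintype.equivFin V
  refine ⟨univ.filter fun v => v ∈ periodicPts f ∧ ∀ i, ρ v ≤ ρ (f^[i] v), fun v => ?_, fun r hr => ?_,
    fun r hr i hi => ?_⟩
  · obtain ⟨a, b, hab, heq⟩ : ∃ a b, a < b ∧ f^[a] v = f^[b] v := by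
      obtain ⟨a, b, hne, h⟩ := Finite.exists_ne_map_eq_of_infinite (fun i : ℕ => f^[i] v)
      rcases lt_or_gt_of_ne hne with h' | h'
      · exact ⟨a, b, h', h⟩
      · exact ⟨b, a, h', h.symm⟩
    have hper : IsPeriodicPt f (b - a) (f^[a] v) := by
      rw [IsPeriodicPt, IsFixedPt, ← iterate_add_apply, Nat.sub_add_cancel hab.le, heq]
    obtain ⟨_, ⟨j, rfl⟩, hmin⟩ := Set.exists_min_image (Set.range fun j => f^[j] (f^[a] v)) ρ
      (Set.toFinite _) (Set.range_nonempty _)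
    refine ⟨j + a, ?_⟩
    rw [iterate_add_apply]
    simp only [mem_filter, mem_univ, true_and]
    refine ⟨mk_mem_periodicPts (Nat.sub_pos_of_lt hab) (hper.apply_iterate j), fun i => ?_⟩
    rw [← iterate_add_apply f i j]
    exact hmin _ ⟨i + j, rfl⟩
  · exact (by simpa using hr : _ ∧ _).1
  · simp only [mem_filter, mem_univ, true_and] at hr hi
    obtain ⟨j, hj⟩ := exists_iterate_eq_of_mem_periodicPts hr.1 i
    have h1 := hi.2 j
    rw [hj] at h1
    exact ρ.injective (le_antisymm h1 (hr.2 i))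

theorem IsCycleTransversal.mul_card_le {V : Type*} [Fintype V] {f : V → V} {R : Finset V}
    (h : IsCycleTransversal f R) (L : ℕ) :
    L * #R ≤ Fintype.card V + L * #{v | minimalPeriod f v ∈ Finset.Icc 1 L} := by
  classical
  set S : Finset V := {v | minimalPeriod f v ∈ Finset.Icc 1 L} with hS
  have hlong : ∀ r ∈ R \ S, L < minimalPeriod f r := by
    intro r hr
    rw [mem_sdiff] at hr
    by_contra hle
    refine hr.2 ?_
    rw [hS, mem_filter]
    exact ⟨mem_univ _, Finset.mem_Icc.2
      ⟨minimalPeriod_pos_of_mem_periodicPts (h.mem_periodicPts r hr.1), not_lt.1 hle⟩⟩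
  have hinj : #((R \ S) ×ˢ range L) ≤ #(univ : Finset V) := by
    refine card_le_card_of_injOn (fun x => f^[x.2] x.1) (fun _ _ => by simp) ?_
    rintro ⟨r, j⟩ hr ⟨r', j'⟩ hr' heq
    simp only [coe_product, Set.mem_prod, mem_coe, mem_range] at hr hr' heq
    obtain ⟨a, ha⟩ := exists_iterate_eq_of_mem_periodicPts
      (h.mem_periodicPts r' (mem_sdiff.1 hr'.1).1) j'
    rw [← heq, ← iterate_add_apply] at ha
    have hrr : r' = r :=
      ha ▸ h.iterate_eq r (mem_sdiff.1 hr.1).1 _ (by rw [ha]; exact (mem_sdiff.1 hr'.1).1)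
    subst hrr
    have := hlong r' hr.1
    rw [iterate_eq_iterate_iff_of_lt_minimalPeriod (by omega) (by omega)] at heq
    rw [heq]
  rw [card_product, card_range, card_univ] at hinj
  have := card_le_card_sdiff_add_card (s := R) (t := S)
  nlinarith

theorem mul_card_minimalPeriod_eq_le {V : Type*} [Fintype V] [DecidableEq V] {s : V → Finset V}
    {d : ℕ} (hs : ∀ u, d ≤ #(s u)) (v : V) {ℓ : ℕ} (hℓ : 1 ≤ ℓ) :
    d * #{f ∈ Fintype.piFinset s | minimalPeriod f v = ℓ} ≤ #(Fintype.piFinset s) := by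
  set A := {f ∈ Fintype.piFinset s | minimalPeriod f v = ℓ} with hA
  have key : ∀ (f : V → V) (w : V), minimalPeriod f v = ℓ → ∀ j ≤ ℓ - 1,
      (update f (f^[ℓ - 1] v) w)^[j] v = f^[j] v := by
    intro f w hf j hj
    induction j with
    | zero => rfl
    | succ j ih =>
      rw [iterate_succ_apply', iterate_succ_apply', ih (by omega), update_of_ne]
      rw [Ne, iterate_eq_iterate_iff_of_lt_minimalPeriod (by omega) (by omega)]
      omega
  have hback : ∀ f : V → V, minimalPeriod f v = ℓ → f (f^[ℓ - 1] v) = v := by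
    intro f hf
    rw [← iterate_succ_apply' f, Nat.succ_eq_add_one, Nat.sub_add_cancel hℓ, ← hf, iterate_minimalPeriod]
  calc d * #A = ∑ f ∈ A, d := by rw [sum_const, smul_eq_mul, mul_comm]
    _ ≤ ∑ f ∈ A, #(s (f^[ℓ - 1] v)) := sum_le_sum fun f _ => hs _
    _ = #(A.sigma fun f => s (f^[ℓ - 1] v)) := (card_sigma _ _).symm
    _ ≤ #(Fintype.piFinset s) := by
      refine card_le_card_of_injOn (fun x => update x.1 (x.1^[ℓ - 1] v) x.2) ?_ ?_
      · rintro ⟨f, w⟩ hx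
        simp only [coe_sigma, Set.mem_sigma_iff, mem_coe, hA, mem_filter, Fintype.mem_piFinset]
          at hx ⊢
        intro a
        by_cases ha : a = f^[ℓ - 1] v
        · subst ha; simpa using hx.2
        · simpa [ha] using hx.1.1 a
      · rintro ⟨f, w⟩ hx ⟨f', w'⟩ hx' heq
        simp only [coe_sigma, Set.mem_sigma_iff, mem_coe, hA, mem_filter] at hx hx'
        dsimp only at heq
        have h1 := key f w hx.1.2 _ le_rfl
        have h2 := key f' w' hx'.1.2 _ le_rfl
        rw [heq, h2] at h1
        have hw : w = w' := by simpa [h1] using congrFun heq (f^[ℓ - 1] v)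
        have hf : f = f' := by
          funext a
          by_cases ha : a = f^[ℓ - 1] v
          · rw [ha, hback f hx.1.2, ← h1, hback f' hx'.1.2]
          · simpa [ha, h1] using congrFun heq a
        subst hf hw
        rfl

/-- Resampling one coordinate leaves the uniform distribution on a product set invariant. -/
theorem sum_piFinset_sum_update {V W : Type*} [Fintype V] [DecidableEq V] (s : V → Finset W)
    (u : V) (Φ : (V → W) → ℝ) :
    ∑ f ∈ Fintype.piFinset s, ∑ w ∈ s u, Φ (update f u w) =
      #(s u) * ∑ f ∈ Fintype.piFinset s, Φ f := by
  calc ∑ f ∈ Fintype.piFinset s, ∑ w ∈ s u, Φ (update f u w)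
      = ∑ x ∈ Fintype.piFinset s ×ˢ s u, Φ (update x.1 u x.2) := by rw [sum_product]
    _ = ∑ x ∈ Fintype.piFinset s ×ˢ s u, Φ x.1 := by
      have hmem : ∀ x ∈ Fintype.piFinset s ×ˢ s u,
          (update x.1 u x.2, x.1 u) ∈ Fintype.piFinset s ×ˢ s u := by
        rintro ⟨f, w⟩ hx
        simp only [mem_product, Fintype.mem_piFinset] at hx ⊢
        refine ⟨fun a => ?_, hx.1 u⟩
        by_cases ha : a = u
        · subst ha; simpa using hx.2
        · simpa [ha] using hx.1 a
      exact sum_nbij' (fun x => (update x.1 u x.2, x.1 u)) (fun x => (update x.1 u x.2, x.1 u))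
        hmem hmem (by simp) (by simp) (by simp)
    _ = #(s u) * ∑ f ∈ Fintype.piFinset s, Φ f := by
      simp [sum_product, mul_sum]

theorem one_add_sum_le_prod_one_add {ι : Type*} (A : Finset ι) {x : ι → ℝ}
    (hx : ∀ i ∈ A, 0 ≤ x i) : 1 + ∑ i ∈ A, x i ≤ ∏ i ∈ A, (1 + x i) := by
  classical
  induction A using Finset.induction_on with
  | empty => simp
  | insert i A hi ih =>
    have h1 := ih fun j hj => hx j (mem_insert_of_mem hj)
    have h2 := hx i (mem_insert_self i A)
    have h3 : 0 ≤ ∑ j ∈ A, x j := sum_nonneg fun j hj => hx j (mem_insert_of_mem hj)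
    rw [sum_insert hi, prod_insert hi]
    nlinarith

/-- The probability that a uniformly random element of `t` equals `v`. -/
noncomputable def hitProb {V : Type*} [DecidableEq V] (t : Finset V) (v : V) : ℝ :=
  if v ∈ t then (#t : ℝ)⁻¹ else 0

section hitProb

variable {V : Type*} [DecidableEq V] (t : Finset V) (v : V)

theorem hitProb_nonneg : 0 ≤ hitProb t v := by unfold hitProb; split_ifs <;> positivity

theorem hitProb_le : hitProb t v ≤ (#t : ℝ)⁻¹ := by
  unfold hitProb; split_ifs <;> first | exact le_rfl | positivity

theorem hitProb_le_one : hitProb t v ≤ 1 :=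
  (hitProb_le t v).trans (Nat.cast_inv_le_one _)

theorem sum_hitProb [Fintype V] {t : Finset V} (ht : t.Nonempty) : ∑ v, hitProb t v = 1 := by
  have : (#t : ℝ) ≠ 0 := by exact_mod_cast ht.card_ne_zero
  simp [hitProb, this]

theorem sum_prod_erase_le {t : Finset V} (ht : t.Nonempty) (A : Finset V) {a : V → ℝ}
    (h0 : ∀ v, 0 < a v) (h1 : ∀ v, a v ≤ 1) :
    ∑ w ∈ t, ∏ v ∈ A.erase w, a v ≤
      #t * ∏ v ∈ A, (1 - (1 - a v) * (1 - hitProb t v)) := by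
  have ht0 : (0 : ℝ) < #t := by exact_mod_cast ht.card_pos
  have hinv : ∀ v, 0 ≤ (a v)⁻¹ - 1 := fun v => sub_nonneg.2 ((one_le_inv₀ (h0 v)).2 (h1 v))
  have hterm : ∀ w, ∏ v ∈ A.erase w, a v =
      (∏ v ∈ A, a v) * (1 + if w ∈ A then (a w)⁻¹ - 1 else 0) := by
    intro w
    split_ifs with hw
    · rw [← mul_prod_erase A a hw]
      have := (h0 w).ne'
      field_simp
      ring
    · rw [erase_eq_of_notMem hw]; ring
  have hfac : ∀ v, 1 - (1 - a v) * (1 - hitProb t v) =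
      a v * (1 + hitProb t v * ((a v)⁻¹ - 1)) := by
    intro v
    have := (h0 v).ne'
    field_simp
    ring
  simp_rw [hterm, hfac]
  rw [← mul_sum, prod_mul_distrib, mul_left_comm]
  refine mul_le_mul_of_nonneg_left ?_ (prod_nonneg fun v _ => (h0 v).le)
  refine le_trans (le_of_eq ?_) (mul_le_mul_of_nonneg_left (one_add_sum_le_prod_one_add A
    fun v _ => mul_nonneg (hitProb_nonneg t v) (hinv v)) ht0.le)
  rw [sum_add_distrib, mul_add, mul_sum, sum_const, nsmul_eq_mul, ← sum_filter,
    filter_mem_eq_inter, inter_comm, ← filter_mem_eq_inter, sum_filter]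
  congr 1
  refine sum_congr rfl fun v _ => ?_
  simp only [hitProb]
  split_ifs
  · field_simp
  · simp

end hitProb

section occupancy

variable {V : Type*} [Fintype V] [DecidableEq V] {s : V → Finset V}

/-- If every vertex `u` chooses a uniformly random element of `s u`, then the events that the
vertices are missed are dominated, in the sense of exponential moments, by independent ones. -/
theorem sum_half_pow_card_missed_le (hs : ∀ u, (s u).Nonempty) :
    ∑ f ∈ Fintype.piFinset s, (1 / 2 : ℝ) ^ #(univ \ univ.image f) ≤
      #(Fintype.piFinset s) * ∏ v, (1 - 1 / 2 * ∏ u, (1 - hitProb (s u) v)) := by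
  let Φ : Finset V → (V → V) → ℝ := fun U f =>
    ∏ v ∈ univ \ U.image f, (1 - 1 / 2 * ∏ u ∈ univ \ U, (1 - hitProb (s u) v))
  have key : ∀ U : Finset V, ∑ f ∈ Fintype.piFinset s, Φ U f ≤ ∑ f ∈ Fintype.piFinset s, Φ ∅ f := by
    intro U
    induction U using Finset.induction_on with
    | empty => exact le_rfl
    | insert u U hu ih =>
      refine le_trans ?_ ih
      have hpos : (0 : ℝ) < #(s u) := by exact_mod_cast (hs u).card_pos
      refine le_of_mul_le_mul_left ?_ hpos
      rw [← sum_piFinset_sum_update, mul_sum]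
      refine sum_le_sum fun f _ => ?_
      let a : V → ℝ := fun v => 1 - 1 / 2 * ∏ x ∈ univ \ insert u U, (1 - hitProb (s x) v)
      have hq0 : ∀ v, 0 ≤ ∏ x ∈ univ \ insert u U, (1 - hitProb (s x) v) := fun v =>
        prod_nonneg fun x _ => sub_nonneg.2 (hitProb_le_one _ _)
      have hq1 : ∀ v, ∏ x ∈ univ \ insert u U, (1 - hitProb (s x) v) ≤ 1 := fun v =>
        prod_le_one (fun x _ => sub_nonneg.2 (hitProb_le_one _ _))
          fun x _ => sub_le_self _ (hitProb_nonneg _ _)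
      have h := sum_prod_erase_le (hs u) (univ \ U.image f) (a := a)
        (fun v => by have := hq1 v; simp only [a]; linarith)
        (fun v => by have := hq0 v; simp only [a]; linarith)
      have hsplit : univ \ U = insert u (univ \ insert u U) := by
        ext x
        by_cases hx : x = u <;> simp [hx, hu]
      have hleft : ∀ w, Φ (insert u U) (update f u w) =
          ∏ v ∈ (univ \ U.image f).erase w, a v := by
        intro w
        have himage : (insert u U).image (update f u w) = insert w (U.image f) := by
          rw [image_insert, update_self]
          congr 1
          exact image_congr fun x hx => update_of_ne (by rintro rfl; exact hu hx) _ _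
        simp only [Φ, himage, a]
        rw [sdiff_insert]
      have hright : Φ U f =
          ∏ v ∈ univ \ U.image f, (1 - (1 - a v) * (1 - hitProb (s u) v)) := by
        refine prod_congr rfl fun v _ => ?_
        rw [hsplit, prod_insert (by simp)]
        simp only [a]
        ring
      simp_rw [hleft]
      rw [hright]
      exact h
  have h := key univ
  have hhalf : (1 : ℝ) - 2⁻¹ = 2⁻¹ := by norm_num
  simpa [Φ, hhalf] using h

theorem card_div_four_le_sum_prod (hs : ∀ u, 4 ≤ #(s u)) :
    (Fintype.card V : ℝ) / 4 ≤ ∑ v, ∏ u, (1 - hitProb (s u) v) := by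
  have hlog : (4 / 3 : ℝ) ≤ Real.log 4 := by
    have : Real.log 4 = 2 * Real.log 2 := by
      rw [← Real.log_rpow (by norm_num)]; norm_num
    rw [this]; linarith [Real.log_two_gt_d9]
  have hfactor : ∀ t : ℝ, 0 ≤ t → t ≤ 1 / 4 → Real.exp (-Real.log 4 * t) ≤ 1 - t := by
    intro t h0 h1
    rw [neg_mul, Real.exp_neg]
    refine inv_le_of_inv_le₀ (by linarith) ?_
    have := Real.add_one_le_exp (Real.log 4 * t)
    refine le_trans ?_ this
    rw [inv_le_iff_one_le_mul₀ (by linarith)]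
    nlinarith [mul_le_mul_of_nonneg_right hlog h0]
  have hsum : ∑ v, ∑ u, hitProb (s u) v = Fintype.card V := by
    rw [sum_comm]
    rw [sum_congr rfl fun u _ => sum_hitProb (card_pos.1 (by have := hs u; omega))]
    simp
  have hv : ∀ v, 1 / 4 * (1 + Real.log 4 - Real.log 4 * ∑ u, hitProb (s u) v) ≤
      ∏ u, (1 - hitProb (s u) v) := by
    intro v
    calc 1 / 4 * (1 + Real.log 4 - Real.log 4 * ∑ u, hitProb (s u) v)
        ≤ 1 / 4 * Real.exp (Real.log 4 - Real.log 4 * ∑ u, hitProb (s u) v) := by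
          have := Real.add_one_le_exp (Real.log 4 - Real.log 4 * ∑ u, hitProb (s u) v)
          linarith
      _ = Real.exp (∑ u, -Real.log 4 * hitProb (s u) v) := by
          rw [← mul_sum, sub_eq_add_neg, Real.exp_add, Real.exp_log (by norm_num), neg_mul]
          ring
      _ = ∏ u, Real.exp (-Real.log 4 * hitProb (s u) v) := Real.exp_sum _ _
      _ ≤ _ := by
          refine prod_le_prod (fun _ _ => (Real.exp_pos _).le) fun u _ =>
            hfactor _ (hitProb_nonneg _ _) ((hitProb_le _ _).trans ?_)
          have : (4 : ℝ) ≤ #(s u) := by exact_mod_cast hs u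
          rw [one_div]
          exact inv_anti₀ (by norm_num) this
  refine le_trans (le_of_eq ?_) (sum_le_sum fun v _ => hv v)
  rw [← mul_sum, sum_sub_distrib, ← mul_sum, hsum]
  simp
  ring

theorem card_few_missed_le (hs : ∀ u, 4 ≤ #(s u)) :
    (#{f ∈ Fintype.piFinset s | (#(univ \ univ.image f) : ℝ) ≤ Fintype.card V / 8} : ℝ) ≤
      #(Fintype.piFinset s) * Real.exp ((Real.log 2 - 1) / 8 * Fintype.card V) := by
  set A := {f ∈ Fintype.piFinset s | (#(univ \ univ.image f) : ℝ) ≤ Fintype.card V / 8} with hA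
  have hlow : #A * Real.exp (-(Real.log 2 / 8 * Fintype.card V)) ≤
      ∑ f ∈ Fintype.piFinset s, (1 / 2 : ℝ) ^ #(univ \ univ.image f) := by
    rw [← nsmul_eq_mul, ← sum_const]
    refine (sum_le_sum fun f hf => ?_).trans
      (sum_le_sum_of_subset_of_nonneg (filter_subset _ _) fun _ _ _ => by positivity)
    have hf' := (mem_filter.1 hf).2
    have h2 : (1 / 2 : ℝ) = Real.exp (-Real.log 2) := by
      rw [Real.exp_neg, Real.exp_log (by norm_num), one_div]
    rw [h2, ← Real.exp_nat_mul]
    refine Real.exp_le_exp.2 ?_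
    nlinarith [mul_le_mul_of_nonneg_left hf' (Real.log_nonneg (by norm_num : (1 : ℝ) ≤ 2))]
  have hprod : ∏ v, (1 - 1 / 2 * ∏ u, (1 - hitProb (s u) v)) ≤
      Real.exp (-(Fintype.card V / 8)) := by
    calc ∏ v, (1 - 1 / 2 * ∏ u, (1 - hitProb (s u) v))
        ≤ ∏ v, Real.exp (-(1 / 2 * ∏ u, (1 - hitProb (s u) v))) := by
          refine prod_le_prod (fun v _ => ?_) fun v _ => Real.one_sub_le_exp_neg _
          have : ∏ u, (1 - hitProb (s u) v) ≤ 1 :=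
            prod_le_one (fun x _ => sub_nonneg.2 (hitProb_le_one _ _))
              fun x _ => sub_le_self _ (hitProb_nonneg _ _)
          linarith
      _ = Real.exp (-(1 / 2 * ∑ v, ∏ u, (1 - hitProb (s u) v))) := by
          rw [← Real.exp_sum, sum_neg_distrib, mul_sum]
      _ ≤ _ := Real.exp_le_exp.2 (by linarith [card_div_four_le_sum_prod hs])
  have hmain := hlow.trans ((sum_half_pow_card_missed_le fun u =>
    card_pos.1 (by have := hs u; omega)).trans
      (mul_le_mul_of_nonneg_left hprod (Nat.cast_nonneg _)))
  rw [Real.exp_neg, ← div_eq_mul_inv, div_le_iff₀ (Real.exp_pos _), mul_assoc,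
    ← Real.exp_add] at hmain
  refine hmain.trans (le_of_eq ?_)
  congr 2
  ring

end occupancy

theorem card_small_finsets_le (V : Type*) [Fintype V] [DecidableEq V] :
    (#{S : Finset V | (#S : ℝ) ≤ Fintype.card V / 10000} : ℝ) ≤
      Real.exp (17 / 10000 * Fintype.card V) := by
  set n := Fintype.card V
  set A : Finset (Finset V) := {S | (#S : ℝ) ≤ n / 10000} with hA
  have hx : Real.exp (-7) ≤ 1 / 1000 := by
    have h1 : Real.exp 7 = Real.exp 1 ^ 7 := by rw [← Real.exp_nat_mul]; norm_num
    have h2 : (2.7 : ℝ) ^ 7 ≤ Real.exp 1 ^ 7 :=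
      pow_le_pow_left₀ (by norm_num) (by linarith [Real.exp_one_gt_d9]) 7
    rw [Real.exp_neg, h1, one_div]
    exact inv_anti₀ (by norm_num) (le_trans (by norm_num) h2)
  have hlow : #A * Real.exp (-(7 / 10000 * n)) ≤ ∑ S : Finset V, Real.exp (-7) ^ #S := by
    rw [← nsmul_eq_mul, ← sum_const]
    refine (sum_le_sum fun S hS => ?_).trans
      (sum_le_sum_of_subset_of_nonneg (subset_univ A) fun _ _ _ => by positivity)
    have hS' := (mem_filter.1 hS).2
    rw [← Real.exp_nat_mul]
    exact Real.exp_le_exp.2 (by linarith)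
  have hup : ∑ S : Finset V, Real.exp (-7) ^ #S ≤ Real.exp (1 / 1000 * n) := by
    have h := Finset.sum_pow_mul_eq_add_pow (Real.exp (-7)) 1 (univ : Finset V)
    simp only [one_pow, mul_one, powerset_univ, card_univ] at h
    rw [h, mul_comm, Real.exp_nat_mul]
    exact pow_le_pow_left₀ (by positivity) ((by linarith : _ ≤ 1 / 1000 + (1 : ℝ)).trans
      (Real.add_one_le_exp _)) _
  have hmain := hlow.trans hup
  rw [Real.exp_neg, ← div_eq_mul_inv, div_le_iff₀ (Real.exp_pos _), ← Real.exp_add] at hmain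
  refine hmain.trans (le_of_eq ?_)
  congr 1
  ring

open scoped Classical in
theorem card_piFinset_le_two_mul_card_small_transversal {V : Type*} [Fintype V] [DecidableEq V]
    [Nonempty V]
    {s : V → Finset V} (hs : ∀ u, 1600000000 ≤ #(s u)) :
    #(Fintype.piFinset s) ≤ 2 * #{f ∈ Fintype.piFinset s |
      ∃ R, IsCycleTransversal f R ∧ (#R : ℝ) ≤ Fintype.card V / 10000} := by
  set n := Fintype.card V with hn
  have hn0 : 0 < n := Fintype.card_pos
  choose R hR using fun f : V → V => exists_isCycleTransversal f
  set F := Fintype.piFinset s with hF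
  have hshort : 40000 * ∑ f ∈ F, #{v | minimalPeriod f v ∈ Finset.Icc 1 40000} ≤ n * #F := by
    have h1 : ∑ f ∈ F, #{v | minimalPeriod f v ∈ Finset.Icc 1 40000} =
        ∑ v : V, ∑ ℓ ∈ Finset.Icc 1 40000, #{f ∈ F | minimalPeriod f v = ℓ} := by
      simp_rw [card_filter]
      rw [sum_comm]
      refine sum_congr rfl fun v _ => ?_
      rw [sum_comm]
      refine sum_congr rfl fun f _ => ?_
      rw [sum_ite_eq]
    have h2 : ∀ v : V, ∀ ℓ ∈ Finset.Icc 1 40000,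
        1600000000 * #{f ∈ F | minimalPeriod f v = ℓ} ≤ #F := fun v ℓ hℓ => by
      convert mul_card_minimalPeriod_eq_le hs v (Finset.mem_Icc.1 hℓ).1 using 3
    have h3 : 1600000000 * ∑ f ∈ F, #{v | minimalPeriod f v ∈ Finset.Icc 1 40000} ≤
        n * (40000 * #F) := by
      rw [h1, mul_sum]
      simp_rw [mul_sum]
      refine (sum_le_sum fun v _ => sum_le_sum fun ℓ hℓ => h2 v ℓ hℓ).trans (le_of_eq ?_)
      simp [hn]
    nlinarith
  have htotal : 20000 * ∑ f ∈ F, #(R f) ≤ n * #F := by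
    have h1 : ∑ f ∈ F, 40000 * #(R f) ≤
        ∑ f ∈ F, (n + 40000 * #{v | minimalPeriod f v ∈ Finset.Icc 1 40000}) :=
      sum_le_sum fun f _ => (hR f).mul_card_le 40000
    rw [← mul_sum, sum_add_distrib, ← mul_sum, sum_const, smul_eq_mul] at h1
    nlinarith
  have hbad : 2 * #{f ∈ F | ¬ (#(R f) : ℝ) ≤ n / 10000} ≤ #F := by
    have h1 : ∑ f ∈ F with ¬ (#(R f) : ℝ) ≤ n / 10000, n ≤ ∑ f ∈ F, 10000 * #(R f) := by
      refine (sum_le_sum fun f hf => ?_).trans (sum_le_sum_of_subset (filter_subset _ _))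
      have h2 := (mem_filter.1 hf).2
      rw [not_le, div_lt_iff₀ (by norm_num)] at h2
      have h3 : n < #(R f) * 10000 := by exact_mod_cast h2
      omega
    rw [sum_const, smul_eq_mul, ← mul_sum] at h1
    nlinarith
  have hgood : #{f ∈ F | (#(R f) : ℝ) ≤ n / 10000} ≤
      #{f ∈ F | ∃ R, IsCycleTransversal f R ∧ (#R : ℝ) ≤ n / 10000} :=
    card_le_card (monotone_filter_right _ fun f _ hf => ⟨R f, hR f, hf⟩)
  have := card_filter_add_card_filter_not (s := F) (fun f => (#(R f) : ℝ) ≤ n / 10000)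
  omega

/-- The vertices `v` whose parent edge in a spanning tree is missing from the arrow graph are at
most as many as the transversal. -/
theorem IsCycleTransversal.card_not_adj_le {V : Type*} [Fintype V] [DecidableEq V] {f p : V → V}
    {R : Finset V} (h : IsCycleTransversal f R) [DecidablePred fun v => (arrowGraph f R).Adj v (p v)]
    (hp : ∀ v w, (arrowGraph f R).Adj v w → p v = w ∨ p w = v) :
    #{v | ¬ (arrowGraph f R).Adj v (p v)} ≤ #R := by
  have hinj : #Rᶜ = #(Rᶜ.image fun v => s(v, f v)) := by
    refine (card_image_of_injOn ?_).symm
    intro v hv w hw heq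
    simp only [coe_compl, Set.mem_compl_iff, mem_coe] at hv hw
    rcases Sym2.eq_iff.1 heq with ⟨h1, -⟩ | ⟨h1, h2⟩
    · exact h1
    · exact absurd (h2 ▸ h1.symm : f (f v) = v) (h.apply_apply_ne hv (h2 ▸ hw))
  have hsub : (Rᶜ.image fun v => s(v, f v)) ⊆
      ({v | (arrowGraph f R).Adj v (p v)} : Finset V).image fun v => s(v, p v) := by
    intro e he
    obtain ⟨v, hv, rfl⟩ := mem_image.1 he
    have hadj : (arrowGraph f R).Adj v (f v) := h.arrowGraph_adj.2 (.inl ⟨mem_compl.1 hv, rfl⟩)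
    rcases hp _ _ hadj with h1 | h1
    · exact mem_image.2 ⟨v, by simpa [h1] using hadj, by rw [h1]⟩
    · exact mem_image.2 ⟨f v, by simpa [h1] using hadj.symm, by rw [h1, Sym2.eq_swap]⟩
  have h1 := (hinj.trans_le (card_le_card hsub)).trans card_image_le
  have h2 := card_filter_add_card_filter_not (s := (univ : Finset V))
    (fun v => (arrowGraph f R).Adj v (p v))
  rw [card_compl] at h1
  have := card_le_univ R
  rw [card_univ] at h2
  omega

section SpanningTrees

variable {V : Type*} [Fintype V] [DecidableEq V] (G : SimpleGraph V) [DecidableRel G.Adj]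

open scoped Classical in
/-- A function following the edges of `G` and having a transversal of size at most `k` can be
recovered from a spanning tree together with three vertex sets of size at most `k`. -/
theorem card_small_transversal_le [Nontrivial V] (hG : G.Connected) (k : ℝ) :
    #{f ∈ Fintype.piFinset fun v => G.neighborFinset v |
      ∃ R, IsCycleTransversal f R ∧ (#R : ℝ) ≤ k} ≤
      {H : SimpleGraph V | H ≤ G ∧ H.IsTree}.ncard * #{S : Finset V | (#S : ℝ) ≤ k} ^ 3 := by
  set 𝒮 : Finset (Finset V) := {S | (#S : ℝ) ≤ k} with h𝒮
  set 𝒯 : Finset (SimpleGraph V) := {H | H ≤ G ∧ H.IsTree} with h𝒯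
  have hncard : {H : SimpleGraph V | H ≤ G ∧ H.IsTree}.ncard = #𝒯 := by
    rw [← Set.ncard_coe_finset]; simp [h𝒯]
  set F := {f ∈ Fintype.piFinset fun v => G.neighborFinset v |
      ∃ R, IsCycleTransversal f R ∧ (#R : ℝ) ≤ k} with hF
  have hcode : ∀ f : V → V, ∃ (T : SimpleGraph V) (R : Finset V), f ∈ F →
      T ∈ 𝒯 ∧ IsCycleTransversal f R ∧ (#R : ℝ) ≤ k ∧ arrowGraph f R ≤ T := by
    intro f
    by_cases hf : f ∈ F
    swap
    · exact ⟨⊥, ∅, fun h => absurd h hf⟩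
    obtain ⟨hfG, R, hR, hRk⟩ := mem_filter.1 hf
    have hle : arrowGraph f R ≤ G := by
      intro x y hxy
      simp only [Fintype.mem_piFinset, SimpleGraph.mem_neighborFinset] at hfG
      rcases hR.arrowGraph_adj.1 hxy with ⟨-, rfl⟩ | ⟨-, rfl⟩
      · exact hfG x
      · exact (hfG y).symm
    obtain ⟨T, hT1, hT2, hT3⟩ := hG.exists_isTree_le_of_le_of_isAcyclic hle hR.isAcyclic_arrowGraph
    exact ⟨T, R, fun _ => ⟨by simp [h𝒯, hT2, hT3], hR, hRk, hT1⟩⟩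
  choose T R hTR using hcode
  have hparent : ∀ H : SimpleGraph V, ∃ p : V → V, H ∈ 𝒯 → ∀ v w, H.Adj v w → p v = w ∨ p w = v := by
    intro H
    by_cases hH : H ∈ 𝒯
    · obtain ⟨p, -, hp⟩ := (mem_filter.1 hH).2.2.exists_parent
      exact ⟨p, fun _ => hp⟩
    · exact ⟨id, fun h => absurd h hH⟩
  choose p hp using hparent
  let D : (V → V) → Finset V := fun f => {v | ¬ (arrowGraph f (R f)).Adj v (p (T f) v)}
  have hpF : ∀ f ∈ F, ∀ v w, (arrowGraph f (R f)).Adj v w → p (T f) v = w ∨ p (T f) w = v :=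
    fun f hf v w hvw => hp _ (hTR f hf).1 v w ((hTR f hf).2.2.2 hvw)
  have hadj : ∀ f ∈ F, ∀ v w, (arrowGraph f (R f)).Adj v w ↔
      (p (T f) v = w ∧ v ∉ D f) ∨ (p (T f) w = v ∧ w ∉ D f) := by
    intro f hf v w
    constructor
    · intro h
      rcases hpF f hf v w h with h1 | h1
      · exact .inl ⟨h1, by simpa [D, h1] using h⟩
      · exact .inr ⟨h1, by simpa [D, h1] using h.symm⟩
    · rintro (⟨rfl, h⟩ | ⟨rfl, h⟩)
      · simpa [D] using h
      · simpa [D, SimpleGraph.adj_comm] using h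
  rw [hncard]
  calc #F ≤ #(𝒯 ×ˢ 𝒮 ×ˢ 𝒮 ×ˢ 𝒮) := by
        refine card_le_card_of_injOn (fun f => (T f, D f, R f, (R f).image f)) ?_ ?_
        · intro f hf
          obtain ⟨h1, h2, h3, -⟩ := hTR f hf
          have h4 : (#(D f) : ℝ) ≤ #(R f) := by exact_mod_cast h2.card_not_adj_le (hpF f hf)
          have h5 : (#((R f).image f) : ℝ) ≤ #(R f) := by exact_mod_cast card_image_le
          simp only [coe_product, Set.mem_prod, mem_coe, h𝒮, mem_filter, mem_univ, true_and]
          exact ⟨h1, h4.trans h3, h3, h5.trans h3⟩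
        · intro f hf g hg heq
          simp only [Prod.mk.injEq] at heq
          obtain ⟨h1, h2, h3, h4⟩ := heq
          have hgraph : arrowGraph f (R f) = arrowGraph g (R g) := by
            ext v w
            rw [hadj f hf, hadj g hg, h1, h2]
          have hg' := (hTR g hg).2.1
          rw [← h3] at hg' h4 hgraph
          exact (hTR f hf).2.1.eq_of_arrowGraph_eq_of_image_eq hg' hgraph h4
    _ = #𝒯 * #𝒮 ^ 3 := by simp only [card_product]; ring

/-- Rooting spanning trees maps those with few leaves injectively to functions missing few
vertices. -/
theorem ncard_few_leaves_le [Nontrivial V] (k : ℝ) :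
    {H : SimpleGraph V | H ≤ G ∧ H.IsTree ∧
      ({v : V | (H.neighborSet v).ncard = 1}.ncard : ℝ) ≤ k}.ncard ≤
      #{f ∈ Fintype.piFinset fun v => G.neighborFinset v |
        (#(univ \ univ.image f) : ℝ) ≤ k} := by
  classical
  have hparent : ∀ H : SimpleGraph V, ∃ p : V → V, H.IsTree →
      (∀ v, H.Adj v (p v)) ∧ ∀ v w, H.Adj v w → p v = w ∨ p w = v := by
    intro H
    by_cases hH : H.IsTree
    · obtain ⟨p, hp⟩ := hH.exists_parent
      exact ⟨p, fun _ => hp⟩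
    · exact ⟨id, fun h => absurd h hH⟩
  choose p hp using hparent
  rw [← Set.ncard_coe_finset]
  refine Set.ncard_le_ncard_of_injOn p ?_ ?_ (Set.toFinite _)
  · rintro H ⟨hHG, hH, hk⟩
    obtain ⟨h1, h2⟩ := hp H hH
    simp only [coe_filter, Fintype.mem_piFinset, SimpleGraph.mem_neighborFinset, Set.mem_ofPred_eq]
    refine ⟨fun v => hHG (h1 v), le_trans ?_ hk⟩
    rw [← Set.ncard_coe_finset]
    refine Nat.cast_le.2 (Set.ncard_le_ncard ?_ (Set.toFinite _))
    intro v hv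
    have hv' : ∀ w, p H w ≠ v := by simpa using hv
    rw [Set.mem_ofPred_eq, Set.ncard_eq_one]
    refine ⟨p H v, ?_⟩
    ext w
    rw [SimpleGraph.mem_neighborSet, Set.mem_singleton_iff]
    constructor
    · intro h
      exact ((h2 v w h).resolve_right (hv' w)).symm
    · rintro rfl
      exact h1 v
  · rintro H ⟨-, hH, -⟩ H' ⟨-, hH', -⟩ heq
    have key : ∀ K : SimpleGraph V, K.IsTree → ∀ v w, K.Adj v w ↔ p K v = w ∨ p K w = v := by
      intro K hK v w
      refine ⟨(hp K hK).2 v w, ?_⟩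
      rintro (rfl | rfl)
      · exact (hp K hK).1 v
      · exact ((hp K hK).1 w).symm
    ext v w
    rw [key H hH, key H' hH', heq]

end SpanningTrees

/-- There exists an absolute constant `C > 0` such that for every `d ≥ 2` and every
sufficiently large `n`: if `G` is a connected graph with `n` vertices and minimum degree
at least `d`, and `𝒯` is a uniformly random spanning tree of `G`, then
`ℙ(𝒯 has at most n/8 leaves) ≤ e^{-(1/32 - C(log d)²/d)n}`. The probability is expressed
as the ratio of the number of spanning trees with at most `n/8` vertices of degree `1`
to the total number of spanning trees. -/
theorem random_spanning_tree_many_leaves :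
    ∃ C : ℝ, 0 < C ∧
      ∀ d : ℕ, 2 ≤ d → ∃ n₀ : ℕ,
        ∀ (V : Type) [Fintype V] [DecidableEq V] (G : SimpleGraph V) [DecidableRel G.Adj],
          n₀ ≤ Fintype.card V → G.Connected → (∀ v : V, d ≤ G.degree v) →
          ({H : SimpleGraph V | H ≤ G ∧ H.IsTree ∧
              ({v : V | (H.neighborSet v).ncard = 1}.ncard : ℝ) ≤ (Fintype.card V : ℝ) / 8}.ncard : ℝ) /
              ({H : SimpleGraph V | H ≤ G ∧ H.IsTree}.ncard : ℝ) ≤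
            Real.exp (-(1 / 32 - C * (Real.log d) ^ 2 / d) * (Fintype.card V : ℝ)) := by
  classical
  refine ⟨200000000, by norm_num, fun d hd => ⟨1000, fun V _ _ G _ hn hG hdeg => ?_⟩⟩
  set n := Fintype.card V with hn_def
  have hn' : (1000 : ℝ) ≤ n := by exact_mod_cast hn
  have : Nontrivial V := Fintype.one_lt_card_iff_nontrivial.1 (by omega)
  set t := {H : SimpleGraph V | H ≤ G ∧ H.IsTree}.ncard with ht
  set b := {H : SimpleGraph V | H ≤ G ∧ H.IsTree ∧
    ({v : V | (H.neighborSet v).ncard = 1}.ncard : ℝ) ≤ (n : ℝ) / 8}.ncard with hb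
  have hd0 : (0 : ℝ) < d := by positivity
  rcases lt_or_ge d 1600000000 with hsmall | hlarge
  · have hbt : (b : ℝ) ≤ t := by
      refine Nat.cast_le.2 (Set.ncard_le_ncard ?_ (Set.toFinite _))
      exact fun H hH => ⟨hH.1, hH.2.1⟩
    refine (div_le_one_of_le₀ hbt (Nat.cast_nonneg _)).trans (Real.one_le_exp ?_)
    refine mul_nonneg ?_ (Nat.cast_nonneg _)
    rw [neg_sub, sub_nonneg, le_div_iff₀ hd0]
    have hlog : 1 / 2 ≤ Real.log d := by
      have h1 : Real.log 2 ≤ Real.log d :=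
        Real.log_le_log (by norm_num) (by exact_mod_cast hd)
      linarith [Real.log_two_gt_d9]
    have hd1 : (d : ℝ) < 1600000000 := by exact_mod_cast hsmall
    nlinarith
  · set F := Fintype.piFinset fun v => G.neighborFinset v with hF
    have hs : ∀ v, 1600000000 ≤ #(G.neighborFinset v) := fun v => by
      rw [SimpleGraph.card_neighborFinset_eq_degree]; exact hlarge.trans (hdeg v)
    set B : ℝ := (#{S : Finset V | (#S : ℝ) ≤ n / 10000} : ℝ) with hB
    have hBle : B ≤ Real.exp (17 / 10000 * n) := by
      convert card_small_finsets_le V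
    have htrees : (#F : ℝ) ≤ 2 * (t * B ^ 3) := by
      have h1 := card_piFinset_le_two_mul_card_small_transversal hs
      have h2 := card_small_transversal_le G hG ((n : ℝ) / 10000)
      have h3 : #F ≤ 2 * (t * #{S : Finset V | (#S : ℝ) ≤ n / 10000} ^ 3) := by
        exact h1.trans (Nat.mul_le_mul_left 2 h2)
      rw [hB]
      exact_mod_cast h3
    have hbad : (b : ℝ) ≤ #F * Real.exp ((Real.log 2 - 1) / 8 * n) := by
      refine le_trans ?_ (card_few_missed_le fun v => le_trans (by norm_num) (hs v))
      exact_mod_cast ncard_few_leaves_le G ((n : ℝ) / 8)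
    have hratio : (b : ℝ) / t ≤ 2 * B ^ 3 * Real.exp ((Real.log 2 - 1) / 8 * n) := by
      refine div_le_of_le_mul₀ (Nat.cast_nonneg _) (by positivity) (hbad.trans ?_)
      refine (mul_le_mul_of_nonneg_right htrees (Real.exp_pos _).le).trans (le_of_eq ?_)
      ring
    calc (b : ℝ) / t ≤ 2 * B ^ 3 * Real.exp ((Real.log 2 - 1) / 8 * n) := hratio
      _ ≤ 2 * Real.exp (17 / 10000 * n) ^ 3 * Real.exp ((Real.log 2 - 1) / 8 * n) := by gcongr
      _ = Real.exp (Real.log 2 + 3 * (17 / 10000 * n) + (Real.log 2 - 1) / 8 * n) := by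
        rw [Real.exp_add, Real.exp_add, Real.exp_log (by norm_num), ← Real.exp_nat_mul]
        norm_num
      _ ≤ _ := by
        refine Real.exp_le_exp.2 ?_
        have h1 : 0 ≤ 200000000 * Real.log d ^ 2 / d * n := by positivity
        nlinarith [Real.log_two_lt_d9]
end
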